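/- arXiv:0802.0890 — 3 statements merged into one kernel-verified Lean document; each statement's English description precedes it below -/
import Mathlib

section
/- Let 0 < α ≤ 1 and let g be analytic on 𝔻 and continuous on the closed disc with |g(z)−g(w)| = o(|z−w|^α) as |z−w| → 0. Then, uniformly in θ, (1/2π)∫_{−π}^{π} |g(e^{i(t+θ)}) − g(e^{iθ})| / (1 − 2r cos t + r²) dt = o((1−r)^{α−1}) as r → 1⁻; that is, for every ε > 0 there exists r₀ < 1 such that for all r ∈ (r₀, 1) and all θ ∈ [−π, π], the integral is at most ε·(1−r)^{α−1}. -/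
open Complex MeasureTheory Set Metric Filter
open scoped ENNReal Classical

noncomputable section

/-- The open unit disc in `ℂ`. -/
def uDisc : Set ℂ := Metric.ball 0 1

/-- The unit circle in `ℂ`. -/
def uCircle : Set ℂ := Metric.sphere (0 : ℂ) 1

/-- `f` is analytic on the open unit disc and continuous on the closed unit disc. -/
def IsDiscReg (f : ℂ → ℂ) : Prop :=
  DifferentiableOn ℂ f uDisc ∧ ContinuousOn f (Metric.closedBall 0 1)

/-- The little-o Lipschitz condition of order `α` on the closed unit disc:
`|f z - f w| = o(|z-w|^α)` as `|z - w| → 0`. -/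
def LittleLip (α : ℝ) (f : ℂ → ℂ) : Prop :=
  ∀ ε > 0, ∃ δ > 0, ∀ z ∈ Metric.closedBall (0 : ℂ) 1, ∀ w ∈ Metric.closedBall (0 : ℂ) 1,
    ‖z - w‖ < δ → ‖f z - f w‖ ≤ ε * ‖z - w‖ ^ α

/-- Membership in `lip_α`. -/
def MemLip (α : ℝ) (f : ℂ → ℂ) : Prop := IsDiscReg f ∧ LittleLip α f

/-- The Dirichlet integral `D(f) = ∫_𝔻 |f'|² dA` with respect to the normalized
area measure `dA = (1/π)·(Lebesgue)`. -/
def dirInt (f : ℂ → ℂ) : ℝ := (1 / Real.pi) * ∫ z in uDisc, ‖deriv f z‖ ^ 2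

/-- Membership in the Dirichlet space `𝒟`. -/
def MemDir (f : ℂ → ℂ) : Prop :=
  DifferentiableOn ℂ f uDisc ∧ IntegrableOn (fun z => ‖deriv f z‖ ^ 2) uDisc

/-- Sup norm over the unit disc. -/
def supNorm (f : ℂ → ℂ) : ℝ := sSup ((fun z => ‖f z‖) '' uDisc)

/-- The `lip_α` norm `‖f‖_α = ‖f‖_∞ + sup_{z∈𝔻} (1-|z|)^{1-α}|f'(z)|`. -/
def lipNorm (α : ℝ) (f : ℂ → ℂ) : ℝ :=
  supNorm f + sSup ((fun z => (1 - ‖z‖) ^ (1 - α) * ‖deriv f z‖) '' uDisc)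

/-- The `𝒜_α` norm `‖f‖_{𝒜_α} = ‖f‖_α + D(f)^{1/2}`. -/
def ANorm (α : ℝ) (f : ℂ → ℂ) : ℝ := lipNorm α f + Real.sqrt (dirInt f)

/-- Membership in `𝒜_α = 𝒟 ∩ lip_α`. -/
def MemA (α : ℝ) (f : ℂ → ℂ) : Prop := MemDir f ∧ MemLip α f

/-- A closed ideal of the Banach algebra `𝒜_α`, encoded as a set of functions `ℂ → ℂ`
(two functions agreeing on the closed disc represent the same element of `𝒜_α`). -/
structure IsClosedIdeal (α : ℝ) (J : Set (ℂ → ℂ)) : Prop where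
  mem_A : ∀ f ∈ J, MemA α f
  zero_mem : (0 : ℂ → ℂ) ∈ J
  add_mem : ∀ f ∈ J, ∀ g ∈ J, f + g ∈ J
  smul_mem : ∀ (c : ℂ), ∀ f ∈ J, c • f ∈ J
  mul_mem : ∀ f ∈ J, ∀ g : ℂ → ℂ, MemA α g → f * g ∈ J
  ext_mem : ∀ f ∈ J, ∀ g : ℂ → ℂ, MemA α g →
    (∀ z ∈ Metric.closedBall (0 : ℂ) 1, g z = f z) → g ∈ J
  closed : ∀ (F : ℕ → ℂ → ℂ) (f : ℂ → ℂ), (∀ n, F n ∈ J) → MemA α f →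
    Tendsto (fun n => ANorm α (F n - f)) atTop (nhds 0) → f ∈ J

/-- The boundary zero set `E_f = {ξ ∈ 𝕋 : f ξ = 0}`. -/
def bZeros (f : ℂ → ℂ) : Set ℂ := {ξ | ξ ∈ uCircle ∧ f ξ = 0}

/-- An inner function: bounded analytic on `𝔻` with radial limits of modulus `1`
at almost every point of `𝕋`. -/
def IsInner (U : ℂ → ℂ) : Prop :=
  DifferentiableOn ℂ U uDisc ∧ (∀ z ∈ uDisc, ‖U z‖ ≤ 1) ∧
    ∀ᵐ θ : ℝ, Tendsto (fun r : ℝ => ‖U ((r : ℂ) * Complex.exp ((θ : ℂ) * Complex.I))‖)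
      (nhdsWithin 1 (Set.Iio 1)) (nhds 1)

/-- The Schwarz/Herglotz kernel `(e^{iθ}+z)/(e^{iθ}-z)`. -/
def circleKernel (z : ℂ) (θ : ℝ) : ℂ :=
  (Complex.exp ((θ : ℂ) * Complex.I) + z) / (Complex.exp ((θ : ℂ) * Complex.I) - z)

/-- `f` is an outer function. -/
def IsOuter (f : ℂ → ℂ) : Prop :=
  IsDiscReg f ∧ (∃ z ∈ uDisc, f z ≠ 0) ∧
    ∀ z ∈ uDisc, f z = Complex.exp ((1 / (2 * (Real.pi : ℂ))) *
      ∫ θ in (0:ℝ)..(2 * Real.pi),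
        circleKernel z θ * (Real.log ‖f (Complex.exp ((θ : ℂ) * Complex.I))‖ : ℂ))

/-- The outer power `f^ρ`, the outer function with boundary modulus `|f|^ρ`. -/
def outerPow (f : ℂ → ℂ) (ρ : ℝ) (z : ℂ) : ℂ :=
  Complex.exp (((ρ : ℂ) / (2 * (Real.pi : ℂ))) *
    ∫ θ in (0:ℝ)..(2 * Real.pi),
      circleKernel z θ * (Real.log ‖f (Complex.exp ((θ : ℂ) * Complex.I))‖ : ℂ))

/-- The set of angles in `[0, 2π)` whose corresponding point of the circle lies in `A`. -/
def angSet (A : Set ℂ) : Set ℝ :=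
  {θ | θ ∈ Set.Ico (0 : ℝ) (2 * Real.pi) ∧ Complex.exp ((θ : ℂ) * Complex.I) ∈ A}

/-- The outer factor `f_Γ` associated with a boundary set `Γ ⊆ 𝕋`. -/
def outerPart (f : ℂ → ℂ) (Γ : Set ℂ) (z : ℂ) : ℂ :=
  Complex.exp ((1 / (2 * (Real.pi : ℂ))) *
    ∫ θ in angSet Γ, circleKernel z θ * (Real.log ‖f (Complex.exp ((θ : ℂ) * Complex.I))‖ : ℂ))

/-- `𝕋 \ E_f`, the set of boundary points where `f` does not vanish. -/
def offZeros (f : ℂ → ℂ) : Set ℂ := {ξ | ξ ∈ uCircle ∧ f ξ ≠ 0}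

/-- `γ` is a component arc (connected component) of `𝕋 \ E_f`. -/
def IsCompArc (f : ℂ → ℂ) (γ : Set ℂ) : Prop :=
  ∃ x ∈ offZeros f, γ = connectedComponentIn (offZeros f) x

/-- `Γ` is a union of component arcs of `𝕋 \ E_f`. -/
def IsArcUnion (f : ℂ → ℂ) (Γ : Set ℂ) : Prop :=
  Γ ⊆ offZeros f ∧ ∀ x ∈ Γ, connectedComponentIn (offZeros f) x ⊆ Γ

/-- The sector `Δ_γ = {z ∈ 𝔻 : z/|z| ∈ γ}`. -/
def discSector (γ : Set ℂ) : Set ℂ := {z | z ∈ uDisc ∧ ((‖z‖ : ℂ))⁻¹ * z ∈ γ}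

/-- Lower integral of `g` over `S` with respect to the normalized area measure
`dA = (1/π)·(Lebesgue)`. -/
def nlint (S : Set ℂ) (g : ℂ → ℝ) : ℝ≥0∞ :=
  ENNReal.ofReal (1 / Real.pi) * ∫⁻ z in S, ENNReal.ofReal (g z)

/-- `d(z) = min(|z-a|, |z-b|)`, distance to the endpoints of the arc `γ = (a,b)`. -/
def dd (a b z : ℂ) : ℝ := min ‖z - a‖ ‖z - b‖

/-- `Λ_γ`: equals `Γ` if `γ ⊄ Γ`, and `𝕋 \ Γ` if `γ ⊆ Γ`. -/
def lamSet (Γ γ : Set ℂ) : Set ℂ := if γ ⊆ Γ then uCircle \ Γ else Γ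

/-- The function `a_γ(z) = (1/2π)∫_{Λ_γ} (−log|f(e^{iθ})|)/|e^{iθ}−z|² dθ`. -/
def aFun (f : ℂ → ℂ) (Γ γ : Set ℂ) (z : ℂ) : ℝ :=
  (1 / (2 * Real.pi)) * ∫ θ in angSet (lamSet Γ γ),
    (-(Real.log ‖f (Complex.exp ((θ : ℂ) * Complex.I))‖)) /
      ‖Complex.exp ((θ : ℂ) * Complex.I) - z‖ ^ 2

/-- `Δ_γ¹ = {z ∈ Δ_γ : d(z) < 2(1−|z|)}`. -/
def sector1 (a b : ℂ) (γ : Set ℂ) : Set ℂ :=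
  {z | z ∈ discSector γ ∧ dd a b z < 2 * (1 - ‖z‖)}

/-- `Δ_γ² = {z ∈ Δ_γ : d(z) ≥ 2(1−|z|)}`. -/
def sector2 (a b : ℂ) (γ : Set ℂ) : Set ℂ :=
  {z | z ∈ discSector γ ∧ 2 * (1 - ‖z‖) ≤ dd a b z}

/-- `Δ_γ²¹ = {z ∈ Δ_γ² : a_γ(z) ≤ 8|log d(z)|/d(z)}`. -/
def sector21 (f : ℂ → ℂ) (Γ γ : Set ℂ) (a b : ℂ) : Set ℂ :=
  {z | z ∈ sector2 a b γ ∧ aFun f Γ γ z ≤ 8 * |Real.log (dd a b z)| / dd a b z}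

/-- `Δ_γ²² = {z ∈ Δ_γ² : 8|log d(z)|/d(z) < a_γ(z) < 8|log d(z)|/(1−|z|)}`. -/
def sector22 (f : ℂ → ℂ) (Γ γ : Set ℂ) (a b : ℂ) : Set ℂ :=
  {z | z ∈ sector2 a b γ ∧ 8 * |Real.log (dd a b z)| / dd a b z < aFun f Γ γ z ∧
    aFun f Γ γ z < 8 * |Real.log (dd a b z)| / (1 - ‖z‖)}

/-- `Δ_γ²³ = {z ∈ Δ_γ² : a_γ(z) ≥ 8|log d(z)|/(1−|z|)}`. -/
def sector23 (f : ℂ → ℂ) (Γ γ : Set ℂ) (a b : ℂ) : Set ℂ :=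
  {z | z ∈ sector2 a b γ ∧ 8 * |Real.log (dd a b z)| / (1 - ‖z‖) ≤ aFun f Γ γ z}

/-- `μ_z = 1 − 8|log d(z)|/a_γ(z)`. -/
def muOf (f : ℂ → ℂ) (Γ γ : Set ℂ) (a b : ℂ) (z : ℂ) : ℝ :=
  1 - 8 * |Real.log (dd a b z)| / aFun f Γ γ z

/-- The tail union `Γ_m = ⋃_{p ≥ m} γ_p`. -/
def tailUnion (γ : ℕ → Set ℂ) (m : ℕ) : Set ℂ := ⋃ p ∈ Set.Ici m, γ p

end

theorem LittleLip.eq_of_one {f : ℂ → ℂ} (hf : LittleLip 1 f) {z w : ℂ}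
    (hz : z ∈ closedBall (0 : ℂ) 1) (hw : w ∈ closedBall (0 : ℂ) 1) : f z = f w := by
  have hderiv : ∀ x ∈ closedBall (0 : ℂ) 1,
      HasFDerivWithinAt f (0 : ℂ →L[ℂ] ℂ) (closedBall (0 : ℂ) 1) x := by
    intro x hx
    rw [hasFDerivWithinAt_iff_isLittleO, Asymptotics.isLittleO_iff]
    intro c hc
    obtain ⟨δ, hδ, h⟩ := hf c hc
    filter_upwards [inter_mem_nhdsWithin _ (ball_mem_nhds x hδ)] with y hy
    have := h y hy.1 x hx (by simpa [dist_eq_norm] using hy.2)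
    simpa using this
  have := (convex_closedBall (0 : ℂ) 1).norm_image_sub_le_of_norm_hasFDerivWithin_le (C := 0)
    hderiv (by simp) hw hz
  rw [zero_mul] at this
  exact sub_eq_zero.mp (norm_le_zero_iff.mp this)

theorem exp_ofReal_mul_I_mem_closedBall (x : ℝ) :
    Complex.exp ((x : ℂ) * Complex.I) ∈ closedBall (0 : ℂ) 1 := by
  simp [Complex.norm_exp_ofReal_mul_I]

theorem norm_exp_add_sub_exp_le (t θ : ℝ) :
    ‖Complex.exp (((t + θ : ℝ) : ℂ) * Complex.I) - Complex.exp ((θ : ℂ) * Complex.I)‖ ≤ |t| := by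
  have h : Complex.exp (((t + θ : ℝ) : ℂ) * Complex.I) - Complex.exp ((θ : ℂ) * Complex.I)
      = (Complex.exp (Complex.I * t) - 1) * Complex.exp ((θ : ℂ) * Complex.I) := by
    push_cast
    rw [add_mul, Complex.exp_add, mul_comm (t : ℂ)]
    ring
  rw [h, norm_mul, Complex.norm_exp_ofReal_mul_I, mul_one]
  exact Real.norm_exp_I_mul_ofReal_sub_one_le

/-- The circular kernel denominator dominates `((1 - r) + |t|) ^ 2`. -/
theorem sq_le_one_sub_two_mul_cos_add_sq {r t : ℝ} (hr : 1 / 2 ≤ r) (ht : |t| ≤ Real.pi) :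
    ((1 - r) + |t|) ^ 2 / 16 ≤ 1 - 2 * r * Real.cos t + r ^ 2 := by
  have hc := Real.cos_le_one_sub_mul_cos_sq ht
  have hpi : 1 / 8 ≤ 2 / Real.pi ^ 2 := by
    rw [div_le_div_iff₀ (by norm_num) (by positivity)]
    nlinarith [Real.pi_le_four, Real.pi_pos]
  have h1 : 1 / 8 * t ^ 2 ≤ 2 / Real.pi ^ 2 * t ^ 2 := by gcongr
  have h2 : 1 / 8 * t ^ 2 ≤ 1 - Real.cos t := by linarith
  nlinarith [sq_abs t, sq_nonneg ((1 - r) - |t|), sq_nonneg (1 - r),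
    mul_le_mul_of_nonneg_right hr (sub_nonneg.2 (Real.cos_le_one t))]

/-- A function with the little-o condition has, for each `η`, increments on the circle at most
`η |t| ^ α` up to a quadratic error, uniformly in the base point. -/
theorem LittleLip.exists_norm_exp_sub_le {α : ℝ} (hα : 0 < α) {g : ℂ → ℂ}
    (hg : ContinuousOn g (closedBall 0 1)) (hlip : LittleLip α g) {η : ℝ} (hη : 0 < η) :
    ∃ N : ℝ, 0 ≤ N ∧ ∀ t θ : ℝ,
      ‖g (Complex.exp (((t + θ : ℝ) : ℂ) * Complex.I)) - g (Complex.exp ((θ : ℂ) * Complex.I))‖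
        ≤ η * |t| ^ α + N * t ^ 2 := by
  obtain ⟨δ, hδ, h⟩ := hlip η hη
  obtain ⟨B, hB⟩ := (isCompact_closedBall (0 : ℂ) 1).exists_bound_of_continuousOn hg
  have hB0 : 0 ≤ B := (norm_nonneg _).trans (hB 0 (by simp))
  refine ⟨2 * B / δ ^ 2, by positivity, fun t θ => ?_⟩
  have m1 := exp_ofReal_mul_I_mem_closedBall (t + θ)
  have m2 := exp_ofReal_mul_I_mem_closedBall θ
  have hd := norm_exp_add_sub_exp_le t θ
  rcases lt_or_ge |t| δ with hlt | hge
  · refine (h _ m1 _ m2 (hd.trans_lt hlt)).trans ?_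
    have : η * ‖Complex.exp (((t + θ : ℝ) : ℂ) * Complex.I)
        - Complex.exp ((θ : ℂ) * Complex.I)‖ ^ α ≤ η * |t| ^ α := by gcongr
    exact this.trans (le_add_of_nonneg_right (by positivity))
  · have h1 := (norm_sub_le _ _).trans (add_le_add (hB _ m1) (hB _ m2))
    have h2 : B + B ≤ 2 * B / δ ^ 2 * t ^ 2 := by
      rw [div_mul_eq_mul_div, le_div_iff₀ (by positivity), ← sq_abs t, ← two_mul]
      gcongr
    exact (h1.trans h2).trans (le_add_of_nonneg_left (by positivity))

theorem intervalIntegral_one_add_abs_div_rpow_le {β s : ℝ} (hβ : 1 < β) (hs : 0 < s)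
    {a : ℝ} (ha : 0 ≤ a) :
    ∫ t in (-a)..a, (1 + |t / s|) ^ (-β) ≤ s * ∫ u : ℝ, (1 + |u|) ^ (-β) := by
  have hint : Integrable (fun u : ℝ => (1 + |u|) ^ (-β)) := by
    simpa using integrable_one_add_norm (E := ℝ) (μ := volume) (r := β) (by simpa using hβ)
  rw [intervalIntegral.integral_comp_div (fun u : ℝ => (1 + |u|) ^ (-β)) hs.ne', smul_eq_mul,
    intervalIntegral.integral_of_le (by gcongr; linarith)]
  gcongr ?_ * ?_
  exact setIntegral_le_integral hint (Eventually.of_forall fun u => by positivity)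

theorem rpow_add_div_sq_le {α η N s t : ℝ} (hα : 0 < α) (hη : 0 ≤ η) (hN : 0 ≤ N) (hs : 0 < s) :
    (η * |t| ^ α + N * t ^ 2) / (s + |t|) ^ 2
      ≤ η * (s ^ (α - 2) * (1 + |t / s|) ^ (-(2 - α))) + N := by
  have hpos : 0 < s + |t| := by positivity
  have h1 : |t| ^ α ≤ (s + |t|) ^ α := by gcongr; linarith
  have h2 : t ^ 2 ≤ (s + |t|) ^ 2 := by rw [← sq_abs t]; gcongr; linarith
  have h3 : s ^ (α - 2) * (1 + |t / s|) ^ (-(2 - α)) = (s + |t|) ^ α / (s + |t|) ^ 2 := by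
    rw [neg_sub, ← Real.mul_rpow hs.le (by positivity), abs_div, abs_of_pos hs, mul_add,
      mul_div_cancel₀ _ hs.ne', mul_one, Real.rpow_sub hpos, Real.rpow_two]
  rw [h3, div_le_iff₀ (by positivity), add_mul, mul_assoc, div_mul_cancel₀ _ (by positivity)]
  gcongr

/-- For `g ∈ lip_α`, uniformly in `θ`,
`(1/2π)∫_{−π}^{π} |g(e^{i(t+θ)}) − g(e^{iθ})|/(1 − 2r cos t + r²) dt = o((1−r)^{α−1})`
as `r → 1⁻`. -/
theorem poisson_type_integral_littleo (α : ℝ) (hα0 : 0 < α) (hα1 : α ≤ 1)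
    (g : ℂ → ℂ) (hg : IsDiscReg g) (hlip : LittleLip α g) :
    ∀ ε > 0, ∃ r₀ : ℝ, r₀ < 1 ∧ ∀ r : ℝ, r₀ < r → r < 1 →
      ∀ θ ∈ Set.Icc (-Real.pi) Real.pi,
        (1 / (2 * Real.pi)) * ∫ t in (-Real.pi)..Real.pi,
            ‖g (Complex.exp (((t + θ : ℝ) : ℂ) * Complex.I)) -
              g (Complex.exp ((θ : ℂ) * Complex.I))‖ / (1 - 2 * r * Real.cos t + r ^ 2)
          ≤ ε * (1 - r) ^ (α - 1) := by
  intro ε hε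
  rcases hα1.eq_or_lt with rfl | hα
  · refine ⟨0, by norm_num, fun r _ _ θ _ => ?_⟩
    have h0 (t : ℝ) : g (Complex.exp (((t + θ : ℝ) : ℂ) * Complex.I)) =
        g (Complex.exp ((θ : ℂ) * Complex.I)) :=
      hlip.eq_of_one (exp_ofReal_mul_I_mem_closedBall _) (exp_ofReal_mul_I_mem_closedBall _)
    simpa only [h0, sub_self, norm_zero, zero_div, intervalIntegral.integral_zero, mul_zero,
      Real.rpow_zero, mul_one] using hε.le
  set K : ℝ := ∫ u : ℝ, (1 + |u|) ^ (-(2 - α))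
  have hK0 : 0 ≤ K := integral_nonneg fun u => by positivity
  set η : ℝ := ε / (32 * (K + 1)) with hη
  have hη0 : 0 < η := by positivity
  obtain ⟨N, hN0, hN⟩ := hlip.exists_norm_exp_sub_le hα0 hg.2 hη0
  have hlarge : ∀ᶠ s : ℝ in nhdsWithin 0 (Ioi 0), 32 * N / ε ≤ s ^ (α - 1) :=
    (tendsto_rpow_neg_nhdsGT_zero (by linarith)).eventually_ge_atTop _
  obtain ⟨d, hd0, hd⟩ := mem_nhdsGT_iff_exists_Ioo_subset.mp hlarge
  have hd0 : 0 < d := hd0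
  refine ⟨max (1 / 2) (1 - d), max_lt (by norm_num) (by linarith), fun r hr hr1 θ _ => ?_⟩
  have hr2 : 1 / 2 ≤ r := (le_max_left _ _).trans hr.le
  have hs : 0 < 1 - r := by linarith
  have hsN : 32 * N / ε ≤ (1 - r) ^ (α - 1) :=
    hd ⟨hs, by linarith [le_max_right (1 / 2) (1 - d)]⟩
  rw [div_le_iff₀ hε] at hsN
  set s : ℝ := 1 - r with hs_def
  have hcont : Continuous fun t : ℝ => (1 + |t / s|) ^ (-(2 - α)) :=
    Continuous.rpow_const (by fun_prop) fun t => Or.inl (by positivity)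
  have hbound : ∀ t ∈ Ioc (-Real.pi) Real.pi,
      ‖‖g (Complex.exp (((t + θ : ℝ) : ℂ) * Complex.I)) - g (Complex.exp ((θ : ℂ) * Complex.I))‖ /
        (1 - 2 * r * Real.cos t + r ^ 2)‖
      ≤ 16 * η * s ^ (α - 2) * (1 + |t / s|) ^ (-(2 - α)) + 16 * N := by
    intro t ht
    have hD := sq_le_one_sub_two_mul_cos_add_sq hr2 (abs_le.2 ⟨ht.1.le, ht.2⟩)
    rw [← hs_def] at hD
    have hpos : 0 < (s + |t|) ^ 2 / 16 := by positivity
    rw [Real.norm_of_nonneg (div_nonneg (norm_nonneg _) (hpos.trans_le hD).le)]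
    calc _ ≤ (η * |t| ^ α + N * t ^ 2) / ((s + |t|) ^ 2 / 16) :=
          div_le_div₀ (by positivity) (hN t θ) hpos hD
      _ = 16 * ((η * |t| ^ α + N * t ^ 2) / (s + |t|) ^ 2) := by rw [div_div_eq_mul_div]; ring
      _ ≤ 16 * (η * (s ^ (α - 2) * (1 + |t / s|) ^ (-(2 - α))) + N) := by
          gcongr
          exact rpow_add_div_sq_le hα0 hη0.le hN0 hs
      _ = _ := by ring
  have hint := (le_abs_self _).trans <| intervalIntegral.norm_integral_le_of_norm_le
    (by linarith [Real.pi_pos]) (ae_of_all volume hbound)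
    (Continuous.intervalIntegrable (by fun_prop) _ _)
  have hs1 : s ^ (α - 2) * s = s ^ (α - 1) := by
    rw [← Real.rpow_add_one hs.ne']
    congr 1
    ring
  have hval : ∫ t in (-Real.pi)..Real.pi,
      (16 * η * s ^ (α - 2) * (1 + |t / s|) ^ (-(2 - α)) + 16 * N)
      ≤ 16 * η * K * s ^ (α - 1) + 2 * Real.pi * (16 * N) := by
    rw [intervalIntegral.integral_add (Continuous.intervalIntegrable (by fun_prop) _ _)
      intervalIntegrable_const, intervalIntegral.integral_const_mul,
      intervalIntegral.integral_const, smul_eq_mul, sub_neg_eq_add, ← two_mul, ← hs1]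
    gcongr ?_ + _
    calc _ ≤ 16 * η * s ^ (α - 2) * (s * K) := by
          gcongr
          exact intervalIntegral_one_add_abs_div_rpow_le (by linarith) hs Real.pi_pos.le
      _ = _ := by ring
  have hηK : 16 * η * K ≤ ε / 2 := by
    rw [hη, mul_div_assoc', div_mul_eq_mul_div, div_le_iff₀ (by positivity)]
    nlinarith
  have hP : 0 < s ^ (α - 1) := Real.rpow_pos_of_pos hs _
  have hηP : 16 * η * K * s ^ (α - 1) ≤ 2 * Real.pi * (ε / 2 * s ^ (α - 1)) :=
    (mul_le_mul_of_nonneg_right hηK hP.le).trans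
      (le_mul_of_one_le_left (by positivity) (by linarith [Real.pi_gt_three]))
  rw [one_div_mul_eq_div, div_le_iff₀ (by positivity)]
  refine (hint.trans hval).trans ?_
  have hNP : 2 * Real.pi * (16 * N) ≤ 2 * Real.pi * (ε / 2 * s ^ (α - 1)) :=
    mul_le_mul_of_nonneg_left (by linarith) (by positivity)
  linarith
end

section
/- Let 0 < α ≤ 1/2, let f ∈ 𝒜_α with ‖f‖_{𝒜_α} ≤ 1, and let ρ > 1. Let γ = (a,b) be a component arc of 𝕋\E_f of arclength < 1/2 (so a, b ∈ E_f). Then ∫_γ |f(e^{it})|^{2ρ} / d(e^{it}) dt ≤ C_ρ · ∫_{Δ_γ} |f'(z)|² dA(z), where C_ρ > 0 depends only on ρ and α. -/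
open Complex MeasureTheory Set Metric Filter
open scoped ENNReal Classical

lemma enorm_sub_le_setLIntegral_of_hasDerivAt {h h' : ℝ → ℂ} {t : ℝ} (ht : 0 ≤ t)
    (hc : ContinuousOn h (Icc 0 t)) (hd : ∀ x ∈ Ioo 0 t, HasDerivAt h (h' x) x)
    (hm : Measurable h') :
    ‖h t - h 0‖ₑ ≤ ∫⁻ x in Ioo 0 t, ‖h' x‖ₑ := by
  by_cases hfin : ∫⁻ x in Ioo 0 t, ‖h' x‖ₑ = ∞
  · simp [hfin]
  have hint : IntegrableOn h' (Ioo 0 t) := ⟨hm.aestronglyMeasurable, lt_top_iff_ne_top.2 hfin⟩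
  have hint' : IntervalIntegrable h' volume 0 t :=
    (intervalIntegrable_iff_integrableOn_Ioo_of_le ht).2 hint
  rw [← intervalIntegral.integral_eq_sub_of_hasDerivAt_of_le ht hc hd hint',
    intervalIntegral.integral_of_le ht, integral_Ioc_eq_integral_Ioo]
  exact enorm_integral_le_lintegral_enorm _

lemma setLIntegral_Ioo_rpow_sub_one {κ t : ℝ} (hκ : 0 < κ) (ht : 0 < t) :
    ∫⁻ x in Ioo 0 t, ENNReal.ofReal (x ^ (κ - 1)) = ENNReal.ofReal (t ^ κ / κ) := by
  have hint : IntegrableOn (fun x : ℝ => x ^ (κ - 1)) (Ioo 0 t) :=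
    (intervalIntegrable_iff_integrableOn_Ioo_of_le ht.le).1
      (intervalIntegral.intervalIntegrable_rpow' (by linarith))
  rw [← ofReal_integral_eq_lintegral_ofReal hint]
  · rw [← integral_Ioc_eq_integral_Ioo, ← intervalIntegral.integral_of_le ht.le,
      integral_rpow (Or.inl (by linarith))]
    simp [Real.zero_rpow hκ.ne']
  · filter_upwards [ae_restrict_mem measurableSet_Ioo] with x hx
    exact Real.rpow_nonneg hx.1.le _

/-- A Hardy-type inequality: a pointwise bound `F σ ≤ 3 σ ^ (α - 1)` improves the
(logarithmically divergent) Cauchy-Schwarz estimate against the weight `σ`. -/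
lemma setLIntegral_rpow_le {α ρ : ℝ} (hα : 0 < α) (hρ : 1 < ρ) :
    ∃ C : ℝ≥0∞, C ≠ ∞ ∧ ∀ (F : ℝ → ℝ≥0∞) (t : ℝ), Measurable F → 0 < t →
      (∀ x ∈ Ioo 0 t, F x ≤ ENNReal.ofReal (3 * x ^ (α - 1))) →
      (∫⁻ x in Ioo 0 t, F x) ^ (2 * ρ) ≤
        C * ENNReal.ofReal (t ^ (2 * α * (ρ - 1))) *
          ∫⁻ x in Ioo 0 t, F x ^ (2 : ℝ) * ENNReal.ofReal x := by
  set κ : ℝ := 2 * α * (ρ - 1) / (2 * ρ - 1) with hκdef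
  set q : ℝ := 2 * ρ / (2 * ρ - 1) with hqdef
  have h2 : 0 < 2 * ρ - 1 := by linarith
  have h2' : 2 * ρ - 1 ≠ 0 := h2.ne'
  have hκ : 0 < κ := by
    have : 0 < ρ - 1 := by linarith
    positivity
  have hpq : (2 * ρ).HolderConjugate q := by
    rw [Real.holderConjugate_iff]
    refine ⟨by linarith, ?_⟩
    rw [hqdef]; field_simp; ring
  set K : ℝ := (3 : ℝ) ^ ((1 - 1 / ρ) * q) with hK
  have hK0 : 0 < K := by positivity
  refine ⟨ENNReal.ofReal ((K / κ) ^ (2 * ρ - 1)), ENNReal.ofReal_ne_top, ?_⟩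
  intro F t hF ht hb
  set u : ℝ → ℝ≥0∞ := fun x => F x ^ (1 / ρ) * ENNReal.ofReal x ^ (1 / (2 * ρ)) with hu
  set v : ℝ → ℝ≥0∞ := fun x =>
    ENNReal.ofReal (3 ^ (1 - 1 / ρ) * x ^ ((α - 1) * (1 - 1 / ρ) - 1 / (2 * ρ))) with hv
  have hum : Measurable u := by fun_prop
  have hvm : Measurable v := by fun_prop
  have hρ1 : 0 < 1 - 1 / ρ := by
    rw [sub_pos, div_lt_one] <;> linarith
  have hρ0 : 0 < 1 / ρ := by positivity
  have h1 : ∫⁻ x in Ioo 0 t, F x ≤ ∫⁻ x in Ioo 0 t, (u * v) x := by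
    refine setLIntegral_mono (hum.mul hvm) fun x hx => ?_
    have hx0 : 0 < x := hx.1
    have e1 : F x = F x ^ (1 / ρ) * F x ^ (1 - 1 / ρ) := by
      rw [← ENNReal.rpow_add_of_nonneg _ _ hρ0.le hρ1.le]; simp
    have e2 : F x ^ (1 - 1 / ρ) ≤
        ENNReal.ofReal x ^ (1 / (2 * ρ)) * v x := by
      refine (ENNReal.rpow_le_rpow (hb x hx) hρ1.le).trans_eq ?_
      rw [ENNReal.ofReal_rpow_of_pos (by positivity), ENNReal.ofReal_rpow_of_pos hx0, hv,
        ← ENNReal.ofReal_mul (by positivity)]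
      congr 1
      rw [Real.mul_rpow (by norm_num) (by positivity), ← Real.rpow_mul hx0.le,
        mul_left_comm, ← Real.rpow_add hx0]
      congr 2; ring
    calc F x = F x ^ (1 / ρ) * F x ^ (1 - 1 / ρ) := e1
      _ ≤ F x ^ (1 / ρ) * (ENNReal.ofReal x ^ (1 / (2 * ρ)) * v x) := by gcongr
      _ = (u * v) x := by simp [hu, mul_assoc]
  have h3 := ENNReal.lintegral_mul_le_Lp_mul_Lq (volume.restrict (Ioo 0 t)) hpq
    hum.aemeasurable hvm.aemeasurable
  have hup : ∫⁻ x in Ioo 0 t, u x ^ (2 * ρ) =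
      ∫⁻ x in Ioo 0 t, F x ^ (2 : ℝ) * ENNReal.ofReal x := by
    refine lintegral_congr fun x => ?_
    simp only [hu]
    rw [ENNReal.mul_rpow_of_nonneg _ _ (by linarith), ← ENNReal.rpow_mul, ← ENNReal.rpow_mul]
    have a1 : 1 / ρ * (2 * ρ) = 2 := by field_simp
    have a2 : 1 / (2 * ρ) * (2 * ρ) = 1 := by field_simp
    rw [a1, a2, ENNReal.rpow_one]
  have hvq : ∫⁻ x in Ioo 0 t, v x ^ q = ENNReal.ofReal (K / κ * t ^ κ) := by
    have : ∀ x ∈ Ioo 0 t, v x ^ q = ENNReal.ofReal K * ENNReal.ofReal (x ^ (κ - 1)) := by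
      intro x hx
      have hx0 : 0 < x := hx.1
      simp only [hv]
      rw [ENNReal.ofReal_rpow_of_pos (by positivity), ← ENNReal.ofReal_mul hK0.le,
        Real.mul_rpow (by positivity) (by positivity), ← Real.rpow_mul (by norm_num),
        ← Real.rpow_mul hx0.le]
      congr 3
      rw [hqdef, hκdef, mul_div_assoc', div_sub_one h2', div_left_inj' h2']; field_simp; ring
    rw [setLIntegral_congr_fun measurableSet_Ioo this, lintegral_const_mul _ (by fun_prop),
      setLIntegral_Ioo_rpow_sub_one hκ ht, ← ENNReal.ofReal_mul hK0.le]
    congr 1; ring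
  rw [hup, hvq] at h3
  refine (ENNReal.rpow_le_rpow (h1.trans h3) (by linarith)).trans_eq ?_
  rw [ENNReal.mul_rpow_of_nonneg _ _ (by linarith), ← ENNReal.rpow_mul, ← ENNReal.rpow_mul]
  have a1 : 1 / (2 * ρ) * (2 * ρ) = 1 := by field_simp
  have a2 : 1 / q * (2 * ρ) = 2 * ρ - 1 := by rw [hqdef]; field_simp
  rw [a1, a2, ENNReal.rpow_one, mul_comm, ENNReal.ofReal_rpow_of_pos (by positivity),
    ← ENNReal.ofReal_mul (by positivity), Real.mul_rpow (by positivity) (by positivity),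
    ← Real.rpow_mul ht.le]
  have a3 : κ * (2 * ρ - 1) = 2 * α * (ρ - 1) := div_mul_cancel₀ _ h2'
  rw [a3, ENNReal.ofReal_mul (by positivity)]

lemma mul_setLIntegral_comp_mul_le (Φ : ℝ → ℝ≥0∞) {x : ℝ} (hx : 0 < x) :
    ENNReal.ofReal x * ∫⁻ l in Ioo (1 : ℝ) 2, Φ (l * x) ≤ ∫⁻ y in Ioi 0, Φ y := by
  have h := lintegral_image_eq_lintegral_abs_deriv_mul (s := Ioo (1 : ℝ) 2)
    (f := fun l => l * x) (f' := fun _ => x) measurableSet_Ioo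
    (fun l _ => by simpa using ((hasDerivAt_id l).mul_const x).hasDerivWithinAt)
    (fun l _ m _ hlm => mul_right_cancel₀ hx.ne' hlm) Φ
  rw [abs_of_pos hx, lintegral_const_mul' _ _ ENNReal.ofReal_ne_top] at h
  rw [← h]
  refine lintegral_mono_set ?_
  rintro _ ⟨l, hl, rfl⟩
  exact mul_pos (by linarith [hl.1]) hx

set_option maxHeartbeats 2000000 in
/-- The half-plane estimate near a single boundary zero `c`; `ε = ±1` is the side of `c` on which
the boundary integral is taken. -/
lemma exists_halfStrip_bound {α ρ : ℝ} (hα : 0 < α) (hα1 : α ≤ 1) (hρ : 1 < ρ) :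
    ∃ C : ℝ≥0∞, C ≠ ∞ ∧ ∀ (g : ℂ → ℂ) (c ε ℓ : ℝ), (ε = 1 ∨ ε = -1) → 0 < ℓ → ℓ ≤ Real.pi →
      ContinuousOn g {w | 0 ≤ w.im} → DifferentiableOn ℂ g {w | 0 < w.im} →
      (∀ w : ℂ, 0 < w.im → ‖deriv g w‖ ≤ w.im ^ (α - 1)) → g c = 0 →
      ∫⁻ s in Ioo 0 ℓ, ‖g ((c + ε * s : ℝ) : ℂ)‖ₑ ^ (2 * ρ) * (ENNReal.ofReal s)⁻¹ ≤
        C * ∫⁻ s in Ioo 0 ℓ, ∫⁻ y in Ioi 0, ‖deriv g ⟨c + ε * s, y⟩‖ₑ ^ (2 : ℝ) := by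
  obtain ⟨A, hA, hardy⟩ := setLIntegral_rpow_le hα hρ
  set κ : ℝ := 2 * α * (ρ - 1) with hκdef
  have hκ : 0 < κ := by
    have : 0 < ρ - 1 := by linarith
    positivity
  set B : ℝ≥0∞ := 2 ^ (2 * ρ - 1) * A with hB
  have hBtop : B ≠ ∞ := ENNReal.mul_ne_top (by simp) hA
  set P : ℝ≥0∞ := ENNReal.ofReal ((2 * Real.pi) ^ κ) with hP
  set Q : ℝ≥0∞ := ENNReal.ofReal (Real.pi ^ κ / κ) with hQ
  refine ⟨B * (2 * P + 9 * Q), ENNReal.mul_ne_top hBtop (ENNReal.add_ne_top.2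
    ⟨ENNReal.mul_ne_top (by simp) ENNReal.ofReal_ne_top,
      ENNReal.mul_ne_top (by simp) ENNReal.ofReal_ne_top⟩), ?_⟩
  intro g c ε ℓ hε hℓ hℓπ hgc hgd hgb hg0
  have hopen : IsOpen {w : ℂ | 0 < w.im} := isOpen_lt continuous_const Complex.continuous_im
  have hder : ∀ w : ℂ, 0 < w.im → HasDerivAt g (deriv g w) w := fun w hw =>
    (hgd.differentiableAt (hopen.mem_nhds hw)).hasDerivAt
  have hmk : ∀ x y : ℝ, (⟨x, y⟩ : ℂ) = x + y * I := fun x y => by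
    apply Complex.ext <;> simp
  have hmeas : Measurable (fun p : ℝ × ℝ => ‖deriv g ⟨c + ε * p.1, p.2⟩‖ₑ ^ (2 : ℝ)) := by
    simp only [hmk]
    have : Measurable (fun p : ℝ × ℝ => ((c + ε * p.1 : ℝ) : ℂ) + p.2 * I) := by fun_prop
    exact ((measurable_deriv g).comp this).enorm.pow_const _
  set W : ℝ → ℝ≥0∞ := fun s => ∫⁻ y in Ioi 0, ‖deriv g ⟨c + ε * s, y⟩‖ₑ ^ (2 : ℝ) with hW
  have hWm : Measurable W := hmeas.lintegral_prod_right'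
  set D : ℝ≥0∞ := ∫⁻ s in Ioo 0 ℓ, W s with hD
  set J : ℝ → ℝ≥0∞ := fun l => ∫⁻ x in Ioo 0 ℓ,
    ‖deriv g ⟨c + ε * x, l * x⟩‖ₑ ^ (2 : ℝ) * ENNReal.ofReal x with hJ
  have hJint : ∫⁻ l in Ioo (1 : ℝ) 2, J l ≤ D := by
    simp only [hJ]
    rw [lintegral_lintegral_swap]
    · refine setLIntegral_mono hWm fun x hx => ?_
      rw [lintegral_mul_const' _ _ ENNReal.ofReal_ne_top, mul_comm]
      exact mul_setLIntegral_comp_mul_le (fun y => ‖deriv g ⟨c + ε * x, y⟩‖ₑ ^ (2 : ℝ)) hx.1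
    · refine Measurable.aemeasurable (Measurable.mul ?_ (by fun_prop))
      have : Measurable (fun p : ℝ × ℝ => (p.2, p.1 * p.2)) := by fun_prop
      exact hmeas.comp this
  have hvert : ∀ s ∈ Ioo 0 ℓ, (∫⁻ y in Ioo 0 (2 * s), ‖deriv g ⟨c + ε * s, y⟩‖ₑ) ^ (2 * ρ) ≤
      A * (P * (2 * ENNReal.ofReal s * W s)) := by
    intro s hs
    have hs0 : 0 < s := hs.1
    have hm : Measurable fun y : ℝ => ‖deriv g ⟨c + ε * s, y⟩‖ₑ := by
      simp only [hmk]
      have : Measurable (fun y : ℝ => ((c + ε * s : ℝ) : ℂ) + y * I) := by fun_prop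
      exact ((measurable_deriv g).comp this).enorm
    refine (hardy _ (2 * s) hm (by positivity) ?_).trans ?_
    · intro y hy
      rw [← ofReal_norm]
      refine ENNReal.ofReal_le_ofReal ((hgb _ (show 0 < y from hy.1)).trans ?_)
      have : 0 ≤ y ^ (α - 1) := Real.rpow_nonneg hy.1.le _
      simp only
      linarith
    · rw [mul_assoc]
      gcongr A * ?_
      gcongr ?_ * ?_
      · apply ENNReal.ofReal_le_ofReal
        gcongr
        linarith [hs.2]
      · calc ∫⁻ y in Ioo 0 (2 * s), ‖deriv g ⟨c + ε * s, y⟩‖ₑ ^ (2 : ℝ) * ENNReal.ofReal y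
            ≤ ∫⁻ y in Ioo 0 (2 * s), ‖deriv g ⟨c + ε * s, y⟩‖ₑ ^ (2 : ℝ) *
                ENNReal.ofReal (2 * s) := by
              refine setLIntegral_mono ((hm.pow_const _).mul_const _) fun y hy => ?_
              gcongr
              exact hy.2.le
          _ ≤ W s * ENNReal.ofReal (2 * s) := by
              rw [lintegral_mul_const' _ _ ENNReal.ofReal_ne_top]
              gcongr
              exact lintegral_mono_set Ioo_subset_Ioi_self
          _ = 2 * ENNReal.ofReal s * W s := by
              rw [ENNReal.ofReal_mul (by norm_num)]
              simp [mul_comm]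
  have hnorm : ∀ l ∈ Ioo (1 : ℝ) 2, ‖((ε : ℂ) + l * I)‖ ≤ 3 := fun l hl => by
    refine (norm_add_le _ _).trans ?_
    have : |ε| = 1 := by rcases hε with rfl | rfl <;> simp
    simp only [norm_mul, Complex.norm_I, mul_one, Complex.norm_real, Real.norm_eq_abs, this]
    rw [abs_of_pos (by linarith [hl.1])]
    linarith [hl.2]
  have hray : ∀ s ∈ Ioo 0 ℓ, ∀ l ∈ Ioo (1 : ℝ) 2,
      (∫⁻ x in Ioo 0 s, ‖((ε : ℂ) + l * I) * deriv g ⟨c + ε * x, l * x⟩‖ₑ) ^ (2 * ρ) ≤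
      A * (ENNReal.ofReal (s ^ κ) * (9 * J l)) := by
    intro s hs l hl
    have hm' : Measurable fun x : ℝ => deriv g ⟨c + ε * x, l * x⟩ := by
      simp only [hmk]
      have : Measurable (fun x : ℝ => ((c + ε * x : ℝ) : ℂ) + (l * x : ℝ) * I) := by fun_prop
      exact (measurable_deriv g).comp this
    have hm : Measurable fun x : ℝ => ‖((ε : ℂ) + l * I) * deriv g ⟨c + ε * x, l * x⟩‖ₑ :=
      (hm'.const_mul _).enorm
    have hl0 : 0 < l := by linarith [hl.1]
    refine (hardy _ s hm hs.1 ?_).trans ?_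
    · intro x hx
      rw [← ofReal_norm, norm_mul]
      apply ENNReal.ofReal_le_ofReal
      have h1 : ‖deriv g ⟨c + ε * x, l * x⟩‖ ≤ (l * x) ^ (α - 1) :=
        hgb _ (mul_pos hl0 hx.1)
      have h2 : (l * x) ^ (α - 1) ≤ x ^ (α - 1) :=
        Real.rpow_le_rpow_of_nonpos hx.1 (by nlinarith [hx.1, hl.1]) (by linarith)
      exact mul_le_mul (hnorm l hl) (h1.trans h2) (norm_nonneg _) (by norm_num)
    · rw [mul_assoc]
      gcongr A * (_ * ?_)
      rw [hJ, ← lintegral_const_mul' _ _ (by norm_num)]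
      refine (lintegral_mono_set (Ioo_subset_Ioo_right hs.2.le)).trans ?_
      refine lintegral_mono fun x => ?_
      rw [enorm_mul, ENNReal.mul_rpow_of_nonneg _ _ (by norm_num), ← mul_assoc]
      gcongr
      rw [← ofReal_norm, ENNReal.ofReal_rpow_of_nonneg (norm_nonneg _) (by norm_num),
        show (9 : ℝ≥0∞) = ENNReal.ofReal 9 by norm_num]
      apply ENNReal.ofReal_le_ofReal
      rw [Real.rpow_two]
      nlinarith [hnorm l hl, norm_nonneg ((ε : ℂ) + l * I)]
  have hpath : ∀ s ∈ Ioo 0 ℓ, ∀ l ∈ Ioo (1 : ℝ) 2, ‖g ((c + ε * s : ℝ) : ℂ)‖ₑ ≤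
      (∫⁻ y in Ioo 0 (2 * s), ‖deriv g ⟨c + ε * s, y⟩‖ₑ) +
      ∫⁻ x in Ioo 0 s, ‖((ε : ℂ) + l * I) * deriv g ⟨c + ε * x, l * x⟩‖ₑ := by
    intro s hs l hl
    have hl0 : 0 < l := by linarith [hl.1]
    have hls : 0 < l * s := mul_pos hl0 hs.1
    have v := enorm_sub_le_setLIntegral_of_hasDerivAt (t := l * s)
      (h := fun y : ℝ => g (((c + ε * s : ℝ) : ℂ) + y * I))
      (h' := fun y : ℝ => deriv g (((c + ε * s : ℝ) : ℂ) + y * I) * I) hls.le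
      (by
        refine hgc.comp (by fun_prop) ?_
        intro y hy
        simpa using hy.1)
      (by
        intro y hy
        have e : HasDerivAt (fun y : ℝ => ((c + ε * s : ℝ) : ℂ) + y * I) I y := by
          simpa using ((Complex.ofRealCLM.hasDerivAt (x := y)).mul_const I).const_add
            ((c + ε * s : ℝ) : ℂ)
        exact (hder _ (by simpa using hy.1)).comp y e)
      (by
        have : Measurable (fun y : ℝ => ((c + ε * s : ℝ) : ℂ) + y * I) := by fun_prop
        exact ((measurable_deriv g).comp this).mul_const _)
    have r := enorm_sub_le_setLIntegral_of_hasDerivAt (t := s)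
      (h := fun x : ℝ => g ((c : ℂ) + x * ((ε : ℂ) + l * I)))
      (h' := fun x : ℝ => deriv g ((c : ℂ) + x * ((ε : ℂ) + l * I)) * ((ε : ℂ) + l * I)) hs.1.le
      (by
        refine hgc.comp (by fun_prop) ?_
        intro x hx
        have : 0 ≤ x * l := mul_nonneg hx.1 hl0.le
        simpa using this)
      (by
        intro x hx
        have e : HasDerivAt (fun x : ℝ => (c : ℂ) + x * ((ε : ℂ) + l * I)) ((ε : ℂ) + l * I) x := by
          simpa using ((Complex.ofRealCLM.hasDerivAt (x := x)).mul_const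
            ((ε : ℂ) + l * I)).const_add (c : ℂ)
        have : 0 < x * l := mul_pos hx.1 hl0
        exact (hder _ (by simpa using this)).comp x e)
      (by
        have : Measurable (fun x : ℝ => (c : ℂ) + x * ((ε : ℂ) + l * I)) := by fun_prop
        exact ((measurable_deriv g).comp this).mul_const _)
    have e1 : ∀ x : ℝ, (c : ℂ) + x * ((ε : ℂ) + l * I) = ⟨c + ε * x, l * x⟩ := fun x => by
      apply Complex.ext <;> simp [mul_comm]
    have e2 : ∀ y : ℝ, ((c + ε * s : ℝ) : ℂ) + y * I = ⟨c + ε * s, y⟩ := fun y => (hmk _ _).symm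
    simp only [e1, e2] at v r
    have e3 : (⟨c + ε * s, 0⟩ : ℂ) = ((c + ε * s : ℝ) : ℂ) := rfl
    have e4 : (⟨c + ε * 0, l * 0⟩ : ℂ) = (c : ℂ) := by apply Complex.ext <;> simp
    rw [e3] at v
    rw [e4, hg0, sub_zero] at r
    have tri : ‖g ((c + ε * s : ℝ) : ℂ)‖ₑ ≤
        ‖g ⟨c + ε * s, l * s⟩ - g ((c + ε * s : ℝ) : ℂ)‖ₑ + ‖g ⟨c + ε * s, l * s⟩‖ₑ := by
      rw [← enorm_neg (g ⟨c + ε * s, l * s⟩ - _)]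
      refine le_trans (le_of_eq ?_) (enorm_add_le _ _)
      congr 1; ring
    refine tri.trans (add_le_add (v.trans ?_) (r.trans_eq ?_))
    · have hI : ‖I‖ₑ = 1 := by simp [← ofReal_norm]
      simp only [enorm_mul, hI, mul_one]
      exact lintegral_mono_set
        (Ioo_subset_Ioo_right (mul_le_mul_of_nonneg_right hl.2.le hs.1.le))
    · simp only [mul_comm]
  have hpt : ∀ s ∈ Ioo 0 ℓ, ‖g ((c + ε * s : ℝ) : ℂ)‖ₑ ^ (2 * ρ) ≤
      B * (P * (2 * ENNReal.ofReal s * W s) + ENNReal.ofReal (s ^ κ) * (9 * D)) := by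
    intro s hs
    have h1 : ∀ l ∈ Ioo (1 : ℝ) 2, ‖g ((c + ε * s : ℝ) : ℂ)‖ₑ ^ (2 * ρ) ≤
        B * (P * (2 * ENNReal.ofReal s * W s) + ENNReal.ofReal (s ^ κ) * (9 * J l)) := by
      intro l hl
      refine (ENNReal.rpow_le_rpow (hpath s hs l hl) (by linarith)).trans ?_
      refine (ENNReal.rpow_add_le_mul_rpow_add_rpow _ _ (by linarith)).trans ?_
      rw [hB, mul_assoc, mul_add A]
      gcongr _ * (?_ + ?_)
      · exact hvert s hs
      · exact hray s hs l hl
    have hv1 : volume (Ioo (1 : ℝ) 2) = 1 := by simp; norm_num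
    have hJm : Measurable J := by
      have : Measurable fun p : ℝ × ℝ => ‖deriv g ⟨c + ε * p.2, p.1 * p.2⟩‖ₑ ^ (2 : ℝ) *
          ENNReal.ofReal p.2 := by
        refine Measurable.mul ?_ (by fun_prop)
        have : Measurable (fun p : ℝ × ℝ => (p.2, p.1 * p.2)) := by fun_prop
        exact hmeas.comp this
      exact this.lintegral_prod_right'
    calc ‖g ((c + ε * s : ℝ) : ℂ)‖ₑ ^ (2 * ρ)
        = ∫⁻ _ in Ioo (1 : ℝ) 2, ‖g ((c + ε * s : ℝ) : ℂ)‖ₑ ^ (2 * ρ) := by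
          rw [setLIntegral_const, hv1, mul_one]
      _ ≤ ∫⁻ l in Ioo (1 : ℝ) 2,
          B * (P * (2 * ENNReal.ofReal s * W s) + ENNReal.ofReal (s ^ κ) * (9 * J l)) :=
          setLIntegral_mono (by fun_prop) h1
      _ = B * (P * (2 * ENNReal.ofReal s * W s) +
          ENNReal.ofReal (s ^ κ) * (9 * ∫⁻ l in Ioo (1 : ℝ) 2, J l)) := by
          rw [lintegral_const_mul' _ _ hBtop, lintegral_add_left (by fun_prop),
            setLIntegral_const, hv1, mul_one,
            lintegral_const_mul' _ _ ENNReal.ofReal_ne_top, lintegral_const_mul' _ _ (by norm_num)]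
      _ ≤ _ := by gcongr
  calc ∫⁻ s in Ioo 0 ℓ, ‖g ((c + ε * s : ℝ) : ℂ)‖ₑ ^ (2 * ρ) * (ENNReal.ofReal s)⁻¹
      ≤ ∫⁻ s in Ioo 0 ℓ, B * (P * (2 * W s) + ENNReal.ofReal (s ^ (κ - 1)) * (9 * D)) := by
        refine setLIntegral_mono (by fun_prop) fun s hs => ?_
        have hs0 : ENNReal.ofReal s ≠ 0 := by simpa using hs.1
        refine (mul_le_mul_left (hpt s hs) _).trans_eq ?_
        have e : ENNReal.ofReal (s ^ κ) =
            ENNReal.ofReal (s ^ (κ - 1)) * ENNReal.ofReal s := by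
          rw [← ENNReal.ofReal_mul (Real.rpow_nonneg hs.1.le _), Real.rpow_sub_one hs.1.ne',
            div_mul_cancel₀ _ hs.1.ne']
        rw [e]
        calc _ = B * (P * (2 * W s) + ENNReal.ofReal (s ^ (κ - 1)) * (9 * D)) *
              (ENNReal.ofReal s * (ENNReal.ofReal s)⁻¹) := by ring
          _ = _ := by rw [ENNReal.mul_inv_cancel hs0 ENNReal.ofReal_ne_top, mul_one]
    _ = B * (P * (2 * D) + ENNReal.ofReal (ℓ ^ κ / κ) * (9 * D)) := by
        rw [lintegral_const_mul' _ _ hBtop, lintegral_add_left (by fun_prop),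
          lintegral_const_mul' _ _ ENNReal.ofReal_ne_top, lintegral_const_mul' _ _ (by norm_num),
          lintegral_mul_const _ (by fun_prop), setLIntegral_Ioo_rpow_sub_one hκ hℓ]
    _ ≤ B * (P * (2 * D) + Q * (9 * D)) := by
        have : ℓ ^ κ / κ ≤ Real.pi ^ κ / κ := by gcongr
        gcongr B * (_ + ?_ * _)
        exact ENNReal.ofReal_le_ofReal this
    _ = B * (2 * P + 9 * Q) * D := by ring

lemma MemLip.bddAbove_deriv {α : ℝ} {f : ℂ → ℂ} (hα1 : α ≤ 1) (hf : MemLip α f) :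
    BddAbove ((fun z => (1 - ‖z‖) ^ (1 - α) * ‖deriv f z‖) '' uDisc) := by
  obtain ⟨⟨hd, -⟩, hl⟩ := hf
  obtain ⟨δ, hδ, hδf⟩ := hl 1 one_pos
  refine ⟨(2 + 2 / δ) ^ (1 - α), ?_⟩
  rintro _ ⟨z, hz, rfl⟩
  have hz1 : ‖z‖ < 1 := by simpa [uDisc] using hz
  set m := 1 - ‖z‖ with hm
  have hm0 : 0 < m := by linarith
  set r := min (m / 2) (δ / 2) with hr
  have hr0 : 0 < r := by positivity
  have hrm : r ≤ m / 2 := min_le_left _ _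
  have hrδ : r ≤ δ / 2 := min_le_right _ _
  have hsub : Metric.closedBall z r ⊆ uDisc := by
    intro w hw
    rw [Metric.mem_closedBall, dist_eq_norm] at hw
    have := norm_le_norm_add_norm_sub z w
    rw [norm_sub_rev] at this
    simp only [uDisc, Metric.mem_ball, dist_zero_right]
    linarith
  have hdc : DiffContOnCl ℂ (fun w => f w - f z) (Metric.ball z r) := by
    refine DifferentiableOn.diffContOnCl ?_
    rw [closure_ball z hr0.ne']
    exact (hd.mono hsub).sub_const _
  have hb := Complex.norm_deriv_le_of_forall_mem_sphere_norm_le (C := r ^ α) hr0 hdc (by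
    intro w hw
    have hwr : ‖w - z‖ = r := by simpa [dist_eq_norm] using hw
    have hwd : w ∈ uDisc := hsub (Metric.sphere_subset_closedBall hw)
    have := hδf w (Metric.ball_subset_closedBall hwd) z (Metric.ball_subset_closedBall hz)
      (by linarith)
    rwa [hwr, one_mul] at this)
  rw [deriv_sub_const, ← Real.rpow_sub_one hr0.ne'] at hb
  have hmr : m ≤ r * (2 + 2 / δ) := by
    rcases min_choice (m / 2) (δ / 2) with h | h
    · have : r = m / 2 := h
      have : 0 ≤ r * (2 / δ) := by positivity
      linarith
    · have : r = δ / 2 := h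
      have e : r * (2 / δ) = 1 := by rw [this]; field_simp
      have : 0 ≤ ‖z‖ := norm_nonneg z
      linarith
  calc m ^ (1 - α) * ‖deriv f z‖ ≤ (r * (2 + 2 / δ)) ^ (1 - α) * r ^ (α - 1) := by
        gcongr
    _ = (2 + 2 / δ) ^ (1 - α) := by
        rw [Real.mul_rpow hr0.le (by positivity), mul_right_comm, ← Real.rpow_add hr0]
        simp

lemma norm_deriv_le_of_ANorm_le_one {α : ℝ} {f : ℂ → ℂ} (hα1 : α ≤ 1) (hf : MemA α f)
    (hn : ANorm α f ≤ 1) {z : ℂ} (hz : z ∈ uDisc) :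
    (1 - ‖z‖) ^ (1 - α) * ‖deriv f z‖ ≤ 1 := by
  have h1 := le_csSup (hf.2.bddAbove_deriv hα1) (mem_image_of_mem _ hz)
  have h2 : 0 ≤ supNorm f := Real.sSup_nonneg (by rintro _ ⟨w, -, rfl⟩; exact norm_nonneg _)
  have h3 : 0 ≤ Real.sqrt (dirInt f) := Real.sqrt_nonneg _
  unfold ANorm lipNorm at hn
  linarith

lemma norm_exp_mul_I_eq (w : ℂ) : ‖cexp (w * I)‖ = Real.exp (-w.im) := by
  simp [Complex.norm_exp]

lemma exp_mul_I_mem_uDisc {w : ℂ} (hw : 0 < w.im) : cexp (w * I) ∈ uDisc := by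
  simpa [uDisc, norm_exp_mul_I_eq] using hw

lemma hasDerivAt_comp_exp_mul_I {f : ℂ → ℂ} (hf : DifferentiableOn ℂ f uDisc) {w : ℂ}
    (hw : 0 < w.im) : HasDerivAt (fun w => f (cexp (w * I)))
      (deriv f (cexp (w * I)) * (cexp (w * I) * I)) w := by
  have h1 : HasDerivAt f (deriv f (cexp (w * I))) (cexp (w * I)) :=
    (hf.differentiableAt (Metric.isOpen_ball.mem_nhds (exp_mul_I_mem_uDisc hw))).hasDerivAt
  exact h1.comp w ((hasDerivAt_mul_const I).cexp)

lemma norm_deriv_comp_exp_mul_I_le {α : ℝ} {f : ℂ → ℂ} (hα : 0 ≤ α) (hα1 : α ≤ 1)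
    (hf : DifferentiableOn ℂ f uDisc)
    (hb : ∀ z ∈ uDisc, (1 - ‖z‖) ^ (1 - α) * ‖deriv f z‖ ≤ 1) {w : ℂ} (hw : 0 < w.im) :
    ‖deriv (fun w => f (cexp (w * I))) w‖ ≤ w.im ^ (α - 1) := by
  rw [(hasDerivAt_comp_exp_mul_I hf hw).deriv]
  have h := hb _ (exp_mul_I_mem_uDisc hw)
  rw [norm_mul, norm_mul, Complex.norm_I, mul_one]
  rw [norm_exp_mul_I_eq] at h ⊢
  set y := w.im
  set e := Real.exp (-y) with he
  have he0 : 0 < e := Real.exp_pos _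
  have he1 : e ≤ 1 := Real.exp_le_one_iff.2 (by linarith)
  have hye : y * e ≤ 1 - e := by
    have h1 := Real.add_one_le_exp y
    have h2 : Real.exp y * e = 1 := by rw [he, ← Real.exp_add]; simp
    nlinarith
  have h3 : e ≤ e ^ (1 - α) := by
    conv_lhs => rw [← Real.rpow_one e]
    exact Real.rpow_le_rpow_of_exponent_ge he0 he1 (by linarith)
  set N := ‖deriv f (cexp (w * I))‖
  have hN : 0 ≤ N := norm_nonneg _
  have h4 : y ^ (1 - α) * (N * e) ≤ 1 := by
    calc y ^ (1 - α) * (N * e) ≤ y ^ (1 - α) * (N * e ^ (1 - α)) := by gcongr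
      _ = (y * e) ^ (1 - α) * N := by rw [Real.mul_rpow hw.le he0.le]; ring
      _ ≤ (1 - e) ^ (1 - α) * N := by gcongr
      _ ≤ 1 := h
  rw [show α - 1 = -(1 - α) by ring, Real.rpow_neg hw.le]
  rw [← one_div, le_div_iff₀' (Real.rpow_pos_of_pos hw _)]
  exact h4

lemma exp_mul_I_injOn_strip {p q : ℝ} (hq : q ≤ p + 2 * Real.pi) :
    InjOn (fun w : ℂ => cexp (w * I)) {w | w.re ∈ Ioo p q} := by
  intro w hw v hv h
  obtain ⟨n, hn⟩ := Complex.exp_eq_exp_iff_exists_int.1 h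
  have e : w = v + n * (2 * Real.pi) := by
    refine mul_right_cancel₀ I_ne_zero ?_
    rw [hn]; ring
  have e2 : w.re = v.re + n * (2 * Real.pi) := by
    have := congrArg Complex.re e
    simpa using this
  have hπ := Real.pi_pos
  have h1 : (n : ℝ) < 1 := by
    by_contra hc
    nlinarith [hw.2, hv.1]
  have h2 : (-1 : ℝ) < n := by
    by_contra hc
    nlinarith [hv.2, hw.1]
  have h3 : n = 0 := by
    have a1 : n < 1 := by exact_mod_cast h1
    have a2 : -1 < n := by exact_mod_cast h2
    omega
  rw [e, h3]; simp

lemma lintegral_strip_comp_exp_mul_I {f : ℂ → ℂ} (hf : DifferentiableOn ℂ f uDisc) {p q : ℝ}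
    (hq : q ≤ p + 2 * Real.pi) :
    ∫⁻ s in Ioo p q, ∫⁻ y in Ioi 0, ‖deriv (fun w => f (cexp (w * I))) ⟨s, y⟩‖ₑ ^ (2 : ℝ) =
      ∫⁻ z in (fun w : ℂ => cexp (w * I)) '' {w | w.re ∈ Ioo p q ∧ 0 < w.im},
        ‖deriv f z‖ₑ ^ (2 : ℝ) := by
  set g : ℂ → ℂ := fun w => f (cexp (w * I)) with hg
  set S : Set ℂ := {w | w.re ∈ Ioo p q ∧ 0 < w.im} with hS
  have hSm : MeasurableSet S :=
    (Complex.measurable_re measurableSet_Ioo).inter (Complex.measurable_im measurableSet_Ioi)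
  have hgm : Measurable fun w => ‖deriv g w‖ₑ ^ (2 : ℝ) :=
    (measurable_deriv g).enorm.pow_const _
  have h1 : ∫⁻ s in Ioo p q, ∫⁻ y in Ioi 0, ‖deriv g ⟨s, y⟩‖ₑ ^ (2 : ℝ) =
      ∫⁻ w in S, ‖deriv g w‖ₑ ^ (2 : ℝ) := by
    have hmp := Complex.volume_preserving_equiv_real_prod.symm
    have := hmp.setLIntegral_comp_preimage hSm hgm
    rw [← this]
    have hpre : Complex.measurableEquivRealProd.symm ⁻¹' S = Ioo p q ×ˢ Ioi 0 := by
      ext ⟨x, y⟩; simp [hS, Complex.measurableEquivRealProd]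
    rw [hpre, Measure.volume_eq_prod]
    exact (setLIntegral_prod
      (fun x => ‖deriv g (Complex.measurableEquivRealProd.symm x)‖ₑ ^ (2 : ℝ))
      (hgm.comp Complex.measurableEquivRealProd.symm.measurable).aemeasurable).symm
  have hd : ∀ w ∈ S, HasFDerivWithinAt (fun w : ℂ => cexp (w * I))
      ((ContinuousLinearMap.toSpanSingleton ℂ (cexp (w * I) * I)).restrictScalars ℝ) S w := by
    intro w _
    have : HasDerivAt (fun w : ℂ => cexp (w * I)) (cexp (w * I) * I) w :=
      (hasDerivAt_mul_const I).cexp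
    exact (this.hasFDerivAt.restrictScalars ℝ).hasFDerivWithinAt
  rw [h1, lintegral_image_eq_lintegral_abs_det_fderiv_mul volume hSm hd
    ((exp_mul_I_injOn_strip hq).mono fun w hw => hw.1)]
  refine setLIntegral_congr_fun hSm fun w hw => ?_
  have hdet : ((ContinuousLinearMap.toSpanSingleton ℂ (cexp (w * I) * I)).restrictScalars ℝ).det
      = ‖cexp (w * I)‖ ^ 2 := by
    have := LinearMap.det_restrictScalars (R := ℝ)
      (f := (ContinuousLinearMap.toSpanSingleton ℂ (cexp (w * I) * I) : ℂ →ₗ[ℂ] ℂ))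
    refine this.trans ?_
    rw [LinearMap.det_ring, Algebra.norm_complex_apply, Complex.normSq_eq_norm_sq]
    simp
  rw [hdet, hg, (hasDerivAt_comp_exp_mul_I hf hw.2).deriv, abs_of_nonneg (by positivity),
    enorm_mul, enorm_mul, ENNReal.mul_rpow_of_nonneg _ _ (by norm_num), mul_comm]
  congr 1
  rw [← ofReal_norm I, Complex.norm_I, ENNReal.ofReal_one, mul_one, ← ofReal_norm,
    ENNReal.ofReal_rpow_of_nonneg (norm_nonneg _) (by norm_num), Real.rpow_two]

lemma two_pi_le_abs_sub_of_exp_mul_I_eq {s t : ℝ} (h : cexp (s * I) = cexp (t * I)) (hst : s ≠ t) :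
    2 * Real.pi ≤ |s - t| := by
  obtain ⟨n, hn⟩ := Complex.exp_eq_exp_iff_exists_int.1 h
  have e : (s : ℂ) = t + n * (2 * Real.pi) := by
    refine mul_right_cancel₀ I_ne_zero ?_
    rw [hn]; ring
  have e2 : s - t = n * (2 * Real.pi) := by
    have := congrArg Complex.re e
    simp at this
    linarith
  have hn0 : n ≠ 0 := by
    rintro rfl
    simp at e2
    exact hst (by linarith)
  have h1 : (1 : ℝ) ≤ |(n : ℝ)| := by exact_mod_cast Int.one_le_abs hn0
  rw [e2, abs_mul, abs_of_pos Real.two_pi_pos]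
  nlinarith [Real.two_pi_pos]

lemma exp_add_two_pi_mul_I (t : ℝ) : cexp (((t + 2 * Real.pi : ℝ) : ℂ) * I) = cexp (t * I) := by
  push_cast
  rw [add_mul, Complex.exp_add, Complex.exp_two_pi_mul_I, mul_one]

lemma exists_exp_mul_I_eq {ξ : ℂ} (hξ : ξ ∈ uCircle) (p : ℝ) :
    ∃ t ∈ Ico p (p + 2 * Real.pi), cexp (t * I) = ξ := by
  have hn : ‖ξ‖ = 1 := by simpa [uCircle] using hξ
  have hper : Function.Periodic (fun t : ℝ => cexp (t * I)) (2 * Real.pi) := exp_add_two_pi_mul_I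
  obtain ⟨t, ht, he⟩ := hper.exists_mem_Ico Real.two_pi_pos (Complex.arg ξ) p
  refine ⟨t, ht, he.symm.trans ?_⟩
  have := Complex.norm_mul_exp_arg_mul_I ξ
  simpa [hn] using this

lemma exp_mul_I_mem_uCircle (t : ℝ) : cexp (t * I) ∈ uCircle := by
  simp [uCircle, Complex.norm_exp_ofReal_mul_I]

lemma continuous_comp_exp_mul_I {f : ℂ → ℂ} (hf : ContinuousOn f (Metric.closedBall 0 1)) :
    Continuous fun t : ℝ => f (cexp (t * I)) :=
  hf.comp_continuous (by fun_prop) fun t => Metric.sphere_subset_closedBall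
    (exp_mul_I_mem_uCircle t)

/-- A component of the complement of the boundary zero set is an open arc between two zeros. -/
lemma IsCompArc.exists_eq_image_Ioo {f : ℂ → ℂ} {γ : Set ℂ} {a : ℂ}
    (hf : ContinuousOn f (Metric.closedBall 0 1)) (hγ : IsCompArc f γ) (ha : a ∈ bZeros f) :
    ∃ p q : ℝ, p < q ∧ q ≤ p + 2 * Real.pi ∧ f (cexp (p * I)) = 0 ∧ f (cexp (q * I)) = 0 ∧
      γ = (fun t : ℝ => cexp (t * I)) '' Ioo p q := by
  obtain ⟨x, hx, rfl⟩ := hγ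
  set φ : ℝ → ℂ := fun t => f (cexp (t * I)) with hφ
  have hφc : Continuous φ := continuous_comp_exp_mul_I hf
  have hφp : ∀ t, φ (t + 2 * Real.pi) = φ t := fun t => by
    simp only [hφ, exp_add_two_pi_mul_I]
  obtain ⟨θ, -, hθ⟩ := exists_exp_mul_I_eq hx.1 0
  have hφθ : φ θ ≠ 0 := by simpa [hφ, hθ] using hx.2
  obtain ⟨ta, hta, hta'⟩ := exists_exp_mul_I_eq ha.1 θ
  have hφa : φ ta = 0 := by simpa [hφ, hta'] using ha.2
  have hZ : IsClosed {t | φ t = 0} := isClosed_eq hφc continuous_const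
  have hp := (hZ.inter isClosed_Iic).csSup_mem (s := {t | φ t = 0} ∩ Iic θ)
    ⟨ta - 2 * Real.pi, by
      have := hφp (ta - 2 * Real.pi)
      rw [sub_add_cancel] at this
      exact this.symm.trans hφa, by simp only [mem_Iic]; linarith [hta.2]⟩
    ⟨θ, fun t ht => ht.2⟩
  have hq := (hZ.inter isClosed_Ici).csInf_mem (s := {t | φ t = 0} ∩ Ici θ)
    ⟨ta, hφa, hta.1⟩ ⟨θ, fun t ht => ht.2⟩
  have hpub : ∀ t, φ t = 0 → t ≤ θ → t ≤ sSup ({t | φ t = 0} ∩ Iic θ) := fun t h1 h2 =>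
    le_csSup ⟨θ, fun t ht => ht.2⟩ ⟨h1, h2⟩
  have hqlb : ∀ t, φ t = 0 → θ ≤ t → sInf ({t | φ t = 0} ∩ Ici θ) ≤ t := fun t h1 h2 =>
    csInf_le ⟨θ, fun t ht => ht.2⟩ ⟨h1, h2⟩
  set p := sSup ({t | φ t = 0} ∩ Iic θ)
  set q := sInf ({t | φ t = 0} ∩ Ici θ)
  have hp0 : φ p = 0 := hp.1
  have hq0 : φ q = 0 := hq.1
  have hpθ : p < θ := lt_of_le_of_ne hp.2 (by rintro h; exact hφθ (h ▸ hp0))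
  have hqθ : θ < q := lt_of_le_of_ne hq.2 (by rintro h; exact hφθ (h ▸ hq0))
  have hqp : q ≤ p + 2 * Real.pi := by
    have h0 : φ (p + 2 * Real.pi) = 0 := (hφp p).trans hp0
    rcases le_total θ (p + 2 * Real.pi) with h | h
    · exact hqlb _ h0 h
    · linarith [hpub _ h0 h, Real.pi_pos]
  have hne : ∀ t ∈ Ioo p q, φ t ≠ 0 := by
    intro t ht h0
    rcases le_total θ t with h | h
    · exact absurd (hqlb t h0 h) (not_le.2 ht.2)
    · exact absurd (hpub t h0 h) (not_le.2 ht.1)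
  have hexp : Continuous fun t : ℝ => cexp (t * I) := by fun_prop
  refine ⟨p, q, hpθ.trans hqθ, hqp, hp0, hq0, Subset.antisymm ?_ ?_⟩
  · have hpre : IsPreconnected (connectedComponentIn (offZeros f) x) :=
      isPreconnected_connectedComponentIn
    have hsub := connectedComponentIn_subset (offZeros f) x
    have hA : IsClosed ((fun t : ℝ => cexp (t * I)) '' Icc p q) :=
      (isCompact_Icc.image hexp).isClosed
    have hB : IsClosed ((fun t : ℝ => cexp (t * I)) '' Icc q (p + 2 * Real.pi)) :=
      (isCompact_Icc.image hexp).isClosed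
    have hcover : connectedComponentIn (offZeros f) x ⊆
        ((fun t : ℝ => cexp (t * I)) '' Icc p q) ∪
          ((fun t : ℝ => cexp (t * I)) '' Icc q (p + 2 * Real.pi)) := by
      intro y hy
      obtain ⟨t, ht, rfl⟩ := exists_exp_mul_I_eq (hsub hy).1 p
      rcases le_total t q with h | h
      · exact Or.inl ⟨t, ⟨ht.1, h⟩, rfl⟩
      · exact Or.inr ⟨t, ⟨h, ht.2.le⟩, rfl⟩
    intro y hy
    have hyA : y ∈ (fun t : ℝ => cexp (t * I)) '' Icc p q := by
      by_contra hyA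
      have hyB := (hcover hy).resolve_left hyA
      obtain ⟨z, hz, ⟨s, hs, hsz⟩, ⟨t, ht, htz⟩⟩ := isPreconnected_closed_iff.1 hpre _ _ hA hB
        hcover ⟨x, mem_connectedComponentIn hx, θ, ⟨hpθ.le, hqθ.le⟩, hθ⟩ ⟨y, hy, hyB⟩
      have hz0 : f z ≠ 0 := (hsub hz).2
      have hs0 : φ s ≠ 0 := by simpa [hφ, ← hsz] using hz0
      have ht0 : φ t ≠ 0 := by
        simpa [hφ, htz] using hz0
      have hsp : p < s := lt_of_le_of_ne hs.1 (by rintro rfl; exact hs0 hp0)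
      have hsq : s < q := lt_of_le_of_ne hs.2 (by rintro h; exact hs0 (h ▸ hq0))
      have := two_pi_le_abs_sub_of_exp_mul_I_eq (s := t) (t := s) (htz.trans hsz.symm)
        (by linarith [ht.1] : s < t).ne'
      rw [abs_of_pos (by linarith [ht.1])] at this
      linarith [ht.2]
    obtain ⟨s, hs, rfl⟩ := hyA
    have hs0 : φ s ≠ 0 := (hsub hy).2
    exact ⟨s, ⟨lt_of_le_of_ne hs.1 (by rintro rfl; exact hs0 hp0),
      lt_of_le_of_ne hs.2 (by rintro h; exact hs0 (h ▸ hq0))⟩, rfl⟩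
  · refine IsPreconnected.subset_connectedComponentIn (isPreconnected_Ioo.image _ hexp.continuousOn)
      ⟨θ, ⟨hpθ, hqθ⟩, hθ⟩ ?_
    rintro _ ⟨t, ht, rfl⟩
    exact ⟨exp_mul_I_mem_uCircle t, hne t ht⟩

lemma eq_or_eq_of_mem_closure_image_Ioo {f : ℂ → ℂ} {a : ℂ} {p q : ℝ}
    (hne : ∀ t ∈ Ioo p q, f (cexp (t * I)) ≠ 0) (ha : f a = 0)
    (hcl : a ∈ closure ((fun t : ℝ => cexp (t * I)) '' Ioo p q)) :
    a = cexp (p * I) ∨ a = cexp (q * I) := by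
  have hA : IsClosed ((fun t : ℝ => cexp (t * I)) '' Icc p q) :=
    (isCompact_Icc.image (by fun_prop)).isClosed
  obtain ⟨s, hs, rfl⟩ := closure_minimal (image_mono Ioo_subset_Icc_self) hA hcl
  rcases hs.1.eq_or_lt with rfl | h1
  · exact Or.inl rfl
  rcases hs.2.eq_or_lt with rfl | h2
  · exact Or.inr rfl
  exact absurd ha (hne s ⟨h1, h2⟩)

lemma setLIntegral_angSet_image_Ioo_le {p q : ℝ} (hq : q ≤ p + 2 * Real.pi) (H : ℂ → ℝ≥0∞) :
    ∫⁻ t in angSet ((fun t : ℝ => cexp (t * I)) '' Ioo p q), H (cexp ((t : ℂ) * I)) ≤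
      ∫⁻ t in Ioo p q, H (cexp ((t : ℂ) * I)) := by
  set γ : Set ℂ := (fun t : ℝ => cexp (t * I)) '' Ioo p q
  set F : ℝ → ℝ≥0∞ := fun t => γ.indicator H (cexp (t * I)) with hF
  have hper : Function.Periodic F (2 * Real.pi) := fun t => by
    simp only [hF, exp_add_two_pi_mul_I]
  have hγm : MeasurableSet γ := by
    have hU : Ioo p q = ⋃ n : ℕ, Icc (p + 1 / ((n : ℝ) + 1)) (q - 1 / ((n : ℝ) + 1)) := by
      ext t
      simp only [mem_Ioo, mem_iUnion, mem_Icc]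
      constructor
      · rintro ⟨h1, h2⟩
        obtain ⟨n, hn⟩ := exists_nat_one_div_lt (lt_min (sub_pos.2 h1) (sub_pos.2 h2))
        rw [lt_min_iff] at hn
        exact ⟨n, by linarith [hn.1], by linarith [hn.2]⟩
      · rintro ⟨n, h1, h2⟩
        have : (0 : ℝ) < 1 / ((n : ℝ) + 1) := by positivity
        exact ⟨by linarith, by linarith⟩
    have : γ = ⋃ n : ℕ, (fun t : ℝ => cexp (t * I)) ''
        Icc (p + 1 / ((n : ℝ) + 1)) (q - 1 / ((n : ℝ) + 1)) := by
      rw [← image_iUnion, ← hU]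
    rw [this]
    exact MeasurableSet.iUnion fun n =>
      (isCompact_Icc.image (by fun_prop)).isClosed.measurableSet
  have hTm : MeasurableSet (angSet γ) :=
    measurableSet_Ico.inter ((by fun_prop : Measurable fun t : ℝ => cexp (t * I)) hγm)
  calc ∫⁻ t in angSet γ, H (cexp (t * I)) = ∫⁻ t in angSet γ, F t :=
        setLIntegral_congr_fun hTm fun t ht => (indicator_of_mem ht.2 H).symm
    _ ≤ ∫⁻ t in Ico 0 (2 * Real.pi), F t := lintegral_mono_set fun t ht => ht.1
    _ = ∫⁻ t in Ioc 0 (0 + 2 * Real.pi), F t := by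
        rw [zero_add]; exact setLIntegral_congr Ico_ae_eq_Ioc
    _ = ∫⁻ t in Ioc p (p + 2 * Real.pi), F t :=
        (isAddFundamentalDomain_Ioc Real.two_pi_pos 0).setLIntegral_eq
          (isAddFundamentalDomain_Ioc Real.two_pi_pos p) F hper.map_vadd_zmultiples
    _ ≤ ∫⁻ t in Ioc p (p + 2 * Real.pi), (Ioo p q).indicator (fun t => H (cexp (t * I))) t := by
        refine setLIntegral_mono' measurableSet_Ioc fun t ht => ?_
        by_cases h : cexp (t * I) ∈ γ
        · obtain ⟨s, hs, hst⟩ := h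
          have : s = t := by
            by_contra hne
            have h1 := two_pi_le_abs_sub_of_exp_mul_I_eq hst hne
            rcases abs_cases (s - t) with h2 | h2 <;> linarith [hs.1, hs.2, ht.1, ht.2]
          subst this
          rw [indicator_of_mem hs]
          exact indicator_le_self _ _ _
        · simp [hF, indicator_of_notMem h]
    _ ≤ ∫⁻ t, (Ioo p q).indicator (fun t => H (cexp (t * I))) t := setLIntegral_le_lintegral _ _
    _ = ∫⁻ t in Ioo p q, H (cexp (t * I)) := lintegral_indicator measurableSet_Ioo _

lemma two_div_pi_mul_min_le_norm_exp_sub {s t : ℝ} (h0 : s ≤ t) (h1 : t ≤ s + 2 * Real.pi) :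
    2 / Real.pi * min (t - s) (2 * Real.pi - (t - s)) ≤ ‖cexp (t * I) - cexp (s * I)‖ := by
  have e : ‖cexp (t * I) - cexp (s * I)‖ = ‖cexp (I * ((t - s : ℝ) : ℂ)) - 1‖ := by
    have : cexp (t * I) - cexp (s * I) =
        cexp (s * I) * (cexp (I * ((t - s : ℝ) : ℂ)) - 1) := by
      rw [mul_sub, ← Complex.exp_add, mul_one]
      congr 2; push_cast; ring
    rw [this, norm_mul, Complex.norm_exp_ofReal_mul_I, one_mul]
  rw [e, Complex.norm_exp_I_mul_ofReal_sub_one]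
  refine le_trans ?_ (le_abs_self _)
  rcases le_total (t - s) Real.pi with h | h
  · have := Real.mul_le_sin (x := (t - s) / 2) (by linarith) (by linarith)
    have h2 : 2 / Real.pi * min (t - s) (2 * Real.pi - (t - s)) ≤ 2 / Real.pi * (t - s) := by
      gcongr; exact min_le_left _ _
    linarith
  · have := Real.mul_le_sin (x := Real.pi - (t - s) / 2) (by linarith) (by linarith)
    rw [Real.sin_pi_sub] at this
    have h2 : 2 / Real.pi * min (t - s) (2 * Real.pi - (t - s)) ≤
        2 / Real.pi * (2 * Real.pi - (t - s)) := by
      gcongr; exact min_le_right _ _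
    linarith

lemma two_div_pi_mul_le_dd {a b : ℂ} {p q t r : ℝ} (hq : q ≤ p + 2 * Real.pi)
    (ha : a = cexp (p * I) ∨ a = cexp (q * I)) (hb : b = cexp (p * I) ∨ b = cexp (q * I))
    (hrp : r ≤ t - p) (hrq : r ≤ q - t) (hr : 0 ≤ r) :
    2 / Real.pi * r ≤ dd a b (cexp (t * I)) := by
  have h1 : 2 / Real.pi * r ≤ ‖cexp (t * I) - cexp (p * I)‖ := by
    refine le_trans ?_ (two_div_pi_mul_min_le_norm_exp_sub (by linarith) (by linarith))
    gcongr
    exact le_min hrp (by linarith)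
  have h2 : 2 / Real.pi * r ≤ ‖cexp (t * I) - cexp (q * I)‖ := by
    rw [norm_sub_rev]
    refine le_trans ?_ (two_div_pi_mul_min_le_norm_exp_sub (by linarith) (by linarith))
    gcongr
    exact le_min hrq (by linarith)
  refine le_min ?_ ?_
  · rcases ha with rfl | rfl <;> assumption
  · rcases hb with rfl | rfl <;> assumption

lemma setLIntegral_comp_affine {c ε ℓ : ℝ} (hε : ε = 1 ∨ ε = -1) (F : ℝ → ℝ≥0∞) :
    ∫⁻ s in Ioo 0 ℓ, F (c + ε * s) = ∫⁻ t in (fun s => c + ε * s) '' Ioo 0 ℓ, F t := by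
  have hε0 : ε ≠ 0 := by rcases hε with rfl | rfl <;> norm_num
  have hε1 : |ε| = 1 := by rcases hε with rfl | rfl <;> norm_num
  rw [lintegral_image_eq_lintegral_abs_deriv_mul (f' := fun _ => ε) measurableSet_Ioo
    (fun s _ => by
      simpa using (((hasDerivAt_id s).const_mul ε).const_add c).hasDerivWithinAt)
    (fun s _ t _ h => mul_left_cancel₀ hε0 (add_left_cancel h))]
  simp [hε1]

/-- key lemma. `∫_γ |f(e^{it})|^{2ρ}/d(e^{it}) dt ≤ C_ρ ‖f'‖²_{L²(Δ_γ)}`. -/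
theorem boundary_arc_integral_est (α ρ : ℝ) (hα0 : 0 < α) (hα1 : α ≤ 1/2) (hρ : 1 < ρ) :
    ∃ C : ℝ, 0 < C ∧ ∀ (f : ℂ → ℂ) (γ : Set ℂ) (a b : ℂ),
      MemA α f → ANorm α f ≤ 1 →
      IsCompArc f γ → volume (angSet γ) < ENNReal.ofReal (1/2) →
      a ∈ bZeros f → b ∈ bZeros f → closure γ = insert a (insert b γ) →
      (∫⁻ t in angSet γ, ENNReal.ofReal
          (‖f (Complex.exp ((t : ℂ) * Complex.I))‖ ^ (2 * ρ) /
            dd a b (Complex.exp ((t : ℂ) * Complex.I)))) ≤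
        ENNReal.ofReal C * nlint (discSector γ) (fun z => ‖deriv f z‖ ^ 2) := by
  obtain ⟨K, hK, hstrip⟩ := exists_halfStrip_bound hα0 (by linarith : α ≤ 1) hρ
  have hπ := Real.pi_pos
  set M : ℝ≥0∞ := ENNReal.ofReal (Real.pi / 2) * (2 * K) * ENNReal.ofReal Real.pi with hM
  have hMtop : M ≠ ∞ := ENNReal.mul_ne_top (ENNReal.mul_ne_top ENNReal.ofReal_ne_top
    (ENNReal.mul_ne_top (by norm_num) hK)) ENNReal.ofReal_ne_top
  refine ⟨M.toReal + 1, by positivity, ?_⟩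
  intro f γ a b hf hn hγ _ ha hb hcl
  have hfd : DifferentiableOn ℂ f uDisc := hf.1.1
  have hfc : ContinuousOn f (Metric.closedBall 0 1) := hf.2.1.2
  obtain ⟨p, q, hpq, hq, hp0, hq0, rfl⟩ := hγ.exists_eq_image_Ioo hfc ha
  have hne : ∀ t ∈ Ioo p q, f (cexp (t * I)) ≠ 0 := by
    obtain ⟨x, -, hx⟩ := hγ
    intro t ht
    have : cexp (t * I) ∈ offZeros f :=
      connectedComponentIn_subset _ x (hx ▸ mem_image_of_mem _ ht)
    exact this.2
  have ha' := eq_or_eq_of_mem_closure_image_Ioo hne ha.2 (hcl ▸ mem_insert _ _)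
  have hb' := eq_or_eq_of_mem_closure_image_Ioo hne hb.2
    (hcl ▸ mem_insert_of_mem _ (mem_insert _ _))
  set g : ℂ → ℂ := fun w => f (cexp (w * I)) with hg
  have hgc : ContinuousOn g {w | 0 ≤ w.im} := by
    refine hfc.comp (by fun_prop) fun w hw => ?_
    have : 0 ≤ w.im := hw
    simpa [norm_exp_mul_I_eq] using this
  have hgd : DifferentiableOn ℂ g {w | 0 < w.im} := fun w hw =>
    (hasDerivAt_comp_exp_mul_I hfd hw).differentiableAt.differentiableWithinAt
  have hgb : ∀ w : ℂ, 0 < w.im → ‖deriv g w‖ ≤ w.im ^ (α - 1) := fun w hw =>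
    norm_deriv_comp_exp_mul_I_le hα0.le (by linarith) hfd
      (fun z hz => norm_deriv_le_of_ANorm_le_one (by linarith) hf hn hz) hw
  set W : ℝ → ℝ≥0∞ := fun s => ∫⁻ y in Ioi 0, ‖deriv g ⟨s, y⟩‖ₑ ^ (2 : ℝ) with hW
  set D : ℝ≥0∞ := ∫⁻ s in Ioo p q, W s with hD
  set H : ℂ → ℝ≥0∞ := fun z => ENNReal.ofReal (‖f z‖ ^ (2 * ρ) / dd a b z) with hH
  set ℓ : ℝ := (q - p) / 2 with hℓ
  have hℓ0 : 0 < ℓ := by rw [hℓ]; linarith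
  have half : ∀ c ε : ℝ, (ε = 1 ∨ ε = -1) → g c = 0 →
      (∀ s ∈ Ioo 0 ℓ, s ≤ c + ε * s - p ∧ s ≤ q - (c + ε * s)) →
      ∫⁻ t in (fun s => c + ε * s) '' Ioo 0 ℓ, H (cexp (t * I)) ≤
        ENNReal.ofReal (Real.pi / 2) * (K * D) := by
    intro c ε hε hgz hdist
    rw [← setLIntegral_comp_affine hε (fun t => H (cexp (t * I)))]
    calc ∫⁻ s in Ioo 0 ℓ, H (cexp (((c + ε * s : ℝ) : ℂ) * I))
        ≤ ∫⁻ s in Ioo 0 ℓ, ENNReal.ofReal (Real.pi / 2) *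
            (‖g ((c + ε * s : ℝ) : ℂ)‖ₑ ^ (2 * ρ) * (ENNReal.ofReal s)⁻¹) := by
          refine setLIntegral_mono' measurableSet_Ioo fun s hs => ?_
          have hs0 : 0 < s := hs.1
          have hd := two_div_pi_mul_le_dd hq ha' hb' (hdist s hs).1 (hdist s hs).2 hs0.le
          rw [← ofReal_norm, ENNReal.ofReal_rpow_of_nonneg (norm_nonneg _) (by linarith),
            ← ENNReal.ofReal_inv_of_pos hs0, ← ENNReal.ofReal_mul (by positivity),
            ← ENNReal.ofReal_mul (by positivity)]
          refine ENNReal.ofReal_le_ofReal ?_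
          calc _ ≤ ‖g ((c + ε * s : ℝ) : ℂ)‖ ^ (2 * ρ) / (2 / Real.pi * s) := by
                gcongr
            _ = _ := by field_simp
      _ ≤ ENNReal.ofReal (Real.pi / 2) * (K * ∫⁻ s in Ioo 0 ℓ, W (c + ε * s)) := by
          rw [lintegral_const_mul' _ _ ENNReal.ofReal_ne_top]
          gcongr
          exact hstrip g c ε ℓ hε hℓ0 (by rw [hℓ]; linarith) hgc hgd hgb hgz
      _ ≤ _ := by
          rw [setLIntegral_comp_affine hε W]
          gcongr
          refine lintegral_mono_set ?_
          rintro _ ⟨s, hs, rfl⟩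
          have := hdist s hs
          exact ⟨by linarith [hs.1, this.1], by linarith [hs.1, this.2]⟩
  have hcov : Ioo p q ⊆ ((fun s => p + 1 * s) '' Ioo 0 ℓ ∪ (fun s => q + -1 * s) '' Ioo 0 ℓ) ∪
      {(p + q) / 2} := by
    intro t ht
    rcases lt_trichotomy t ((p + q) / 2) with h | h | h
    · exact Or.inl (Or.inl ⟨t - p, ⟨by linarith [ht.1], by rw [hℓ]; linarith⟩, by ring⟩)
    · exact Or.inr h
    · exact Or.inl (Or.inr ⟨q - t, ⟨by linarith [ht.2], by rw [hℓ]; linarith⟩, by ring⟩)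
  have hup : ∫⁻ t in Ioo p q, H (cexp ((t : ℂ) * I)) ≤
      ENNReal.ofReal (Real.pi / 2) * (2 * K) * D := by
    calc _ ≤ _ := lintegral_mono_set hcov
      _ ≤ _ := lintegral_union_le _ _ _
      _ ≤ _ := add_le_add_left (lintegral_union_le _ _ _) _
      _ ≤ ENNReal.ofReal (Real.pi / 2) * (K * D) + ENNReal.ofReal (Real.pi / 2) * (K * D) + 0 := by
          refine add_le_add (add_le_add (half p 1 (Or.inl rfl) hp0 ?_)
            (half q (-1) (Or.inr rfl) hq0 ?_)) ?_
          · exact fun s hs => ⟨by linarith, by linarith [hs.2, hℓ]⟩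
          · exact fun s hs => ⟨by linarith [hs.2, hℓ], by linarith⟩
          · simp
      _ = _ := by ring
  have hDle : D ≤ ENNReal.ofReal Real.pi *
      nlint (discSector ((fun t : ℝ => cexp (t * I)) '' Ioo p q)) (fun z => ‖deriv f z‖ ^ 2) := by
    have e : ∀ z, ‖deriv f z‖ₑ ^ (2 : ℝ) = ENNReal.ofReal (‖deriv f z‖ ^ 2) := fun z => by
      rw [← ofReal_norm, ENNReal.ofReal_rpow_of_nonneg (norm_nonneg _) (by norm_num),
        Real.rpow_two]
    rw [nlint, ← mul_assoc, ← ENNReal.ofReal_mul hπ.le, mul_one_div_cancel hπ.ne',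
      ENNReal.ofReal_one, one_mul, hD, hW, lintegral_strip_comp_exp_mul_I hfd hq]
    simp only [e]
    refine lintegral_mono_set ?_
    rintro _ ⟨w, hw, rfl⟩
    refine ⟨exp_mul_I_mem_uDisc hw.2, w.re, hw.1, ?_⟩
    simp only
    rw [norm_exp_mul_I_eq, Complex.ofReal_exp, ← Complex.exp_neg, ← Complex.exp_add]
    congr 1
    apply Complex.ext <;> simp
  calc _ ≤ ∫⁻ t in Ioo p q, H (cexp ((t : ℂ) * I)) := setLIntegral_angSet_image_Ioo_le hq H
    _ ≤ _ := hup
    _ ≤ _ := mul_le_mul_right hDle _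
    _ = M * nlint (discSector ((fun t : ℝ => cexp (t * I)) '' Ioo p q))
          (fun z => ‖deriv f z‖ ^ 2) := by rw [hM]; ring
    _ ≤ _ := by
        gcongr
        rw [ENNReal.le_ofReal_iff_toReal_le hMtop (by positivity)]
        linarith
end

section
/- Let 0 < α ≤ 1/2, let f ∈ 𝒜_α with ‖f‖_{𝒜_α} ≤ 1, let ρ > 1, and let γ be a component arc of 𝕋\E_f of arclength < 1/2. Then ∫_{Δ_γ} |f(z) − f(z/|z|)|^{2ρ} / (1−|z|)² dA(z) ≤ C_{α,ρ} · ∫_{Δ_γ} |f'(z)|² dA(z), where C_{α,ρ} > 0 depends only on α and ρ (one may take C_{α,ρ} proportional to 1/(2α(ρ−1))). -/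
open Complex MeasureTheory Set Metric Filter
open scoped ENNReal Classical

/-- `∫_t^1 (1-s)^{-1/2} ds ≤ 2 (1-t)^{1/2}`. -/
theorem lintegral_one_sub_rpow_neg_half_le {t : ℝ} (ht : t < 1) :
    ∫⁻ s in Ioo t 1, ENNReal.ofReal ((1 - s) ^ (-(1 / 2) : ℝ)) ≤
      ENNReal.ofReal (2 * (1 - t) ^ (1 / 2 : ℝ)) := by
  have hint : IntervalIntegrable (fun s : ℝ => (1 - s) ^ (-(1 / 2) : ℝ)) volume t 1 := by
    have h := (intervalIntegral.intervalIntegrable_rpow' (a := 1 - t) (b := 0)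
      (show (-1 : ℝ) < -(1 / 2) by norm_num)).comp_sub_left 1
    simpa using h
  rw [intervalIntegrable_iff_integrableOn_Ioo_of_le ht.le] at hint
  rw [← ofReal_integral_eq_lintegral_ofReal hint
    ((ae_restrict_mem measurableSet_Ioo).mono fun s hs =>
      Real.rpow_nonneg (by linarith [hs.2]) _)]
  refine ENNReal.ofReal_le_ofReal (le_of_eq ?_)
  rw [← integral_Ioc_eq_integral_Ioo, ← intervalIntegral.integral_of_le ht.le,
    intervalIntegral.integral_comp_sub_left (fun x : ℝ => x ^ (-(1 / 2) : ℝ)),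
    integral_rpow (Or.inl (by norm_num))]
  norm_num
  ring

/-- `∫_0^s (1-t)^{-3/2} dt ≤ 2 (1-s)^{-1/2}`. -/
theorem lintegral_one_sub_rpow_neg_three_half_le {s : ℝ} (hs0 : 0 < s) (hs : s < 1) :
    ∫⁻ t in Ioo 0 s, ENNReal.ofReal ((1 - t) ^ (-(3 / 2) : ℝ)) ≤
      ENNReal.ofReal (2 * (1 - s) ^ (-(1 / 2) : ℝ)) := by
  have h0 : (0 : ℝ) ∉ uIcc (1 - s) 1 := by
    rw [uIcc_of_le (by linarith)]
    exact fun h => by linarith [h.1]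
  have hint : IntervalIntegrable (fun s : ℝ => (1 - s) ^ (-(3 / 2) : ℝ)) volume 0 s := by
    have h := (intervalIntegral.intervalIntegrable_rpow (μ := volume) (r := -(3 / 2))
      (Or.inr h0)).symm.comp_sub_left 1
    simpa using h
  rw [intervalIntegrable_iff_integrableOn_Ioo_of_le hs0.le] at hint
  rw [← ofReal_integral_eq_lintegral_ofReal hint
    ((ae_restrict_mem measurableSet_Ioo).mono fun t ht =>
      Real.rpow_nonneg (by linarith [ht.2]) _)]
  refine ENNReal.ofReal_le_ofReal ?_
  rw [← integral_Ioc_eq_integral_Ioo, ← intervalIntegral.integral_of_le hs0.le,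
    intervalIntegral.integral_comp_sub_left (fun x : ℝ => x ^ (-(3 / 2) : ℝ)),
    integral_rpow (Or.inr ⟨by norm_num, by simpa using h0⟩)]
  norm_num
  linarith

/-- Weighted Cauchy–Schwarz estimate for a tail integral. -/
theorem sq_lintegral_tail_le {h : ℝ → ℝ≥0∞} (hh : Measurable h) {t : ℝ} (ht : t < 1) :
    (∫⁻ s in Ioo t 1, h s) ^ 2 ≤ ENNReal.ofReal (2 * (1 - t) ^ (1 / 2 : ℝ)) *
      ∫⁻ s in Ioo t 1, ENNReal.ofReal ((1 - s) ^ (1 / 2 : ℝ)) * h s ^ 2 := by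
  have hm : ∀ p : ℝ, Measurable fun s : ℝ => ENNReal.ofReal ((1 - s) ^ p) := fun p => by
    fun_prop
  have hsplit : ∫⁻ s in Ioo t 1, h s = ∫⁻ s in Ioo t 1,
      ((fun s => ENNReal.ofReal ((1 - s) ^ (1 / 4 : ℝ)) * h s) *
        fun s => ENNReal.ofReal ((1 - s) ^ (-(1 / 4) : ℝ))) s := by
    refine setLIntegral_congr_fun measurableSet_Ioo fun s hs => ?_
    have h1 : 0 < 1 - s := by linarith [hs.2]
    have h2 : ENNReal.ofReal ((1 - s) ^ (1 / 4 : ℝ)) *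
        ENNReal.ofReal ((1 - s) ^ (-(1 / 4) : ℝ)) = 1 := by
      rw [← ENNReal.ofReal_mul (by positivity), ← Real.rpow_add h1]
      norm_num
    simp only [Pi.mul_apply]
    rw [mul_right_comm, h2, one_mul]
  have hcs := ENNReal.lintegral_mul_le_Lp_mul_Lq (volume.restrict (Ioo t 1))
    Real.HolderConjugate.two_two
    (f := fun s => ENNReal.ofReal ((1 - s) ^ (1 / 4 : ℝ)) * h s)
    ((hm (1 / 4)).mul hh).aemeasurable (hm (-(1 / 4))).aemeasurable
  rw [← hsplit] at hcs
  have hsq : ∀ x : ℝ≥0∞, (x ^ (1 / 2 : ℝ)) ^ 2 = x := fun x => by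
    rw [← ENNReal.rpow_natCast, ← ENNReal.rpow_mul]
    norm_num
  have hpow : ∀ s ∈ Ioo t 1, ∀ p : ℝ, ENNReal.ofReal ((1 - s) ^ p) ^ 2 =
      ENNReal.ofReal ((1 - s) ^ (2 * p)) := fun s hs p => by
    have h1 : 0 < 1 - s := by linarith [hs.2]
    rw [← ENNReal.ofReal_pow (by positivity), ← Real.rpow_natCast, ← Real.rpow_mul h1.le,
      mul_comm p]
    norm_num
  calc (∫⁻ s in Ioo t 1, h s) ^ 2 ≤ _ := pow_le_pow_left' hcs 2
    _ = (∫⁻ s in Ioo t 1, ENNReal.ofReal ((1 - s) ^ (-(1 / 2) : ℝ))) *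
        ∫⁻ s in Ioo t 1, ENNReal.ofReal ((1 - s) ^ (1 / 2 : ℝ)) * h s ^ 2 := by
      rw [mul_pow, hsq, hsq, mul_comm]
      congr 1
      · refine setLIntegral_congr_fun measurableSet_Ioo fun s hs => ?_
        simp only [ENNReal.rpow_two]
        rw [hpow s hs]
        norm_num
      · refine setLIntegral_congr_fun measurableSet_Ioo fun s hs => ?_
        simp only [ENNReal.rpow_two]
        rw [mul_pow, hpow s hs]
        norm_num
    _ ≤ _ := by gcongr; exact lintegral_one_sub_rpow_neg_half_le ht

/-- Hardy's inequality on `(0, 1)` with the weight `t dt`. -/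
theorem hardy_lintegral_le {h : ℝ → ℝ≥0∞} (hh : Measurable h) :
    ∫⁻ t in Ioo (0 : ℝ) 1, ENNReal.ofReal t *
        (ENNReal.ofReal ((1 - t) ^ (-2 : ℝ)) * (∫⁻ s in Ioo t 1, h s) ^ 2) ≤
      4 * ∫⁻ s in Ioo (0 : ℝ) 1, ENNReal.ofReal s * h s ^ 2 := by
  let k : ℝ → ℝ≥0∞ := fun t => ENNReal.ofReal t * (2 * ENNReal.ofReal ((1 - t) ^ (-(3 / 2) : ℝ)))
  let v : ℝ → ℝ≥0∞ := fun s => ENNReal.ofReal ((1 - s) ^ (1 / 2 : ℝ)) * h s ^ 2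
  have hk : Measurable k := by fun_prop
  have hv : Measurable v := by fun_prop
  calc _ ≤ ∫⁻ t in Ioo (0 : ℝ) 1, ∫⁻ s in Ioo (0 : ℝ) 1,
        {p : ℝ × ℝ | p.1 < p.2}.indicator (fun p => k p.1 * v p.2) (t, s) := by
        refine setLIntegral_mono' measurableSet_Ioo fun t ht => ?_
        have h1 : 0 < 1 - t := by linarith [ht.2]
        have hw : ENNReal.ofReal ((1 - t) ^ (-2 : ℝ)) *
            ENNReal.ofReal (2 * (1 - t) ^ (1 / 2 : ℝ)) =
            2 * ENNReal.ofReal ((1 - t) ^ (-(3 / 2) : ℝ)) := by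
          rw [ENNReal.ofReal_mul zero_le_two, mul_left_comm,
            ← ENNReal.ofReal_mul (by positivity), ← Real.rpow_add h1]
          norm_num
        have hset : ∫⁻ s in Ioo (0 : ℝ) 1,
            {p : ℝ × ℝ | p.1 < p.2}.indicator (fun p => k p.1 * v p.2) (t, s) =
            k t * ∫⁻ s in Ioo t 1, v s := by
          rw [← lintegral_const_mul _ hv, ← lintegral_indicator measurableSet_Ioo,
            ← lintegral_indicator measurableSet_Ioo]
          congr 1 with s
          by_cases h2 : t < s <;> by_cases h3 : s < 1 <;>
            simp [indicator, h2, h3, show t < s → 0 < s from fun h => ht.1.trans h]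
        rw [hset]
        calc _ ≤ ENNReal.ofReal t * (ENNReal.ofReal ((1 - t) ^ (-2 : ℝ)) *
              (ENNReal.ofReal (2 * (1 - t) ^ (1 / 2 : ℝ)) * ∫⁻ s in Ioo t 1, v s)) := by
              gcongr
              exact sq_lintegral_tail_le hh ht.2
          _ = _ := by
              rw [← mul_assoc (ENNReal.ofReal ((1 - t) ^ (-2 : ℝ))), hw, ← mul_assoc]
    _ = ∫⁻ s in Ioo (0 : ℝ) 1, ∫⁻ t in Ioo (0 : ℝ) 1,
        {p : ℝ × ℝ | p.1 < p.2}.indicator (fun p => k p.1 * v p.2) (t, s) := by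
        refine lintegral_lintegral_swap (Measurable.aemeasurable ?_)
        exact (by fun_prop : Measurable fun p : ℝ × ℝ => k p.1 * v p.2).indicator
          (measurableSet_lt measurable_fst measurable_snd)
    _ ≤ ∫⁻ s in Ioo (0 : ℝ) 1, 4 * (ENNReal.ofReal s * h s ^ 2) := by
        refine setLIntegral_mono' measurableSet_Ioo fun s hs => ?_
        have h1 : 0 < 1 - s := by linarith [hs.2]
        have hset : ∫⁻ t in Ioo (0 : ℝ) 1,
            {p : ℝ × ℝ | p.1 < p.2}.indicator (fun p => k p.1 * v p.2) (t, s) =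
            (∫⁻ t in Ioo 0 s, k t) * v s := by
          rw [← lintegral_mul_const _ hk, ← lintegral_indicator measurableSet_Ioo,
            ← lintegral_indicator measurableSet_Ioo]
          congr 1 with t
          by_cases h2 : t < s <;> by_cases h3 : 0 < t <;>
            simp [indicator, h2, h3, show t < s → t < 1 from fun h => h.trans hs.2]
        have hkle : ∫⁻ t in Ioo 0 s, k t ≤
            ENNReal.ofReal s * (2 * ENNReal.ofReal (2 * (1 - s) ^ (-(1 / 2) : ℝ))) := by
          calc _ ≤ ∫⁻ t in Ioo 0 s,
                ENNReal.ofReal s * (2 * ENNReal.ofReal ((1 - t) ^ (-(3 / 2) : ℝ))) := by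
                refine setLIntegral_mono' measurableSet_Ioo fun t ht => ?_
                dsimp only [k]
                gcongr
                exact ht.2.le
            _ ≤ _ := by
                rw [lintegral_const_mul _ (by fun_prop), lintegral_const_mul _ (by fun_prop)]
                gcongr
                exact lintegral_one_sub_rpow_neg_three_half_le hs.1 hs.2
        have hone : ENNReal.ofReal ((1 - s) ^ (-(1 / 2) : ℝ)) *
            ENNReal.ofReal ((1 - s) ^ (1 / 2 : ℝ)) = 1 := by
          rw [← ENNReal.ofReal_mul (by positivity), ← Real.rpow_add h1]
          norm_num
        rw [hset]
        calc _ ≤ _ := mul_le_mul_left hkle (v s)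
          _ = (2 * 2) * (ENNReal.ofReal s * h s ^ 2) * (ENNReal.ofReal ((1 - s) ^ (-(1 / 2) : ℝ)) *
            ENNReal.ofReal ((1 - s) ^ (1 / 2 : ℝ))) := by
              rw [ENNReal.ofReal_mul zero_le_two, ENNReal.ofReal_ofNat]
              dsimp only [v]
              ring
          _ = _ := by rw [hone, mul_one]; norm_num
    _ = _ := lintegral_const_mul _ (by fun_prop)

/-- Functions in the unit ball of `𝒜_α` are bounded by `1` on the closed disc. -/
theorem norm_le_one_of_ANorm_le {α : ℝ} {f : ℂ → ℂ} (hf : ContinuousOn f (closedBall 0 1))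
    (hN : ANorm α f ≤ 1) {z : ℂ} (hz : z ∈ closedBall (0 : ℂ) 1) : ‖f z‖ ≤ 1 := by
  have hsup : supNorm f ≤ 1 := by
    have h1 : 0 ≤ sSup ((fun z => (1 - ‖z‖) ^ (1 - α) * ‖deriv f z‖) '' uDisc) := by
      refine Real.sSup_nonneg ?_
      rintro _ ⟨w, hw, rfl⟩
      have : ‖w‖ < 1 := by simpa [uDisc] using hw
      exact mul_nonneg (Real.rpow_nonneg (by linarith) _) (norm_nonneg _)
    have h2 := Real.sqrt_nonneg (dirInt f)
    simp only [ANorm, lipNorm] at hN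
    linarith
  have hbdd : BddAbove ((fun z => ‖f z‖) '' uDisc) :=
    ((isCompact_closedBall (0 : ℂ) 1).bddAbove_image hf.norm).mono
      (image_mono ball_subset_closedBall)
  have hcl : closure uDisc = closedBall (0 : ℂ) 1 := closure_ball 0 one_ne_zero
  exact le_on_closure (s := uDisc) (f := fun z => ‖f z‖) (g := fun _ => 1)
    (fun w hw => (le_csSup hbdd (mem_image_of_mem _ hw)).trans hsup)
    (hcl ▸ hf.norm) continuousOn_const (hcl ▸ hz)

/-- The radial increment of `f` is at most the integral of `|f'|` along the radius. -/
theorem enorm_radial_sub_le {f : ℂ → ℂ} (hf : IsDiscReg f) {ξ : ℂ} (hξ : ‖ξ‖ = 1) {t : ℝ}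
    (ht0 : 0 < t) (ht : t < 1) :
    ‖f (t * ξ) - f ξ‖ₑ ≤ ∫⁻ s in Ioo t 1, ‖deriv f (s * ξ)‖ₑ := by
  have hbound : ∀ u ∈ Ioo t 1, ‖f (t * ξ) - f (u * ξ)‖ₑ ≤
      ∫⁻ s in Ioo t 1, ‖deriv f (s * ξ)‖ₑ := fun u hu => by
    have hmem : ∀ s ∈ uIcc t u, (s : ℂ) * ξ ∈ ball (0 : ℂ) 1 := fun s hs => by
      rw [uIcc_of_le hu.1.le] at hs
      rw [mem_ball_zero_iff, norm_mul, hξ, mul_one, Complex.norm_real, Real.norm_eq_abs, abs_lt]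
      constructor <;> linarith [hs.1, hs.2, hu.2]
    have hderiv : ∀ s ∈ uIcc t u,
        HasDerivAt (fun s : ℝ => f (s * ξ)) (deriv f (s * ξ) * ξ) s := fun s hs => by
      have h1 := ((hf.1.differentiableAt (isOpen_ball.mem_nhds (hmem s hs))).hasDerivAt)
      have h2 : HasDerivAt (fun z : ℂ => z * ξ) ξ (s : ℂ) := by
        simpa using (hasDerivAt_id (s : ℂ)).mul_const ξ
      exact (h1.comp (s : ℂ) h2).comp_ofReal
    have hcont : ContinuousOn (fun s : ℝ => deriv f (s * ξ) * ξ) (uIcc t u) := by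
      refine ContinuousOn.mul ?_ continuousOn_const
      exact (hf.1.deriv isOpen_ball).continuousOn.comp (by fun_prop) hmem
    have hftc := intervalIntegral.integral_eq_sub_of_hasDerivAt hderiv hcont.intervalIntegrable
    rw [enorm_sub_rev, ← hftc, intervalIntegral.integral_of_le hu.1.le]
    calc _ ≤ ∫⁻ s in Ioc t u, ‖deriv f (s * ξ) * ξ‖ₑ := enorm_integral_le_lintegral_enorm _
      _ = ∫⁻ s in Ioc t u, ‖deriv f (s * ξ)‖ₑ := by
          have : ‖ξ‖ₑ = 1 := by rw [← ofReal_norm, hξ, ENNReal.ofReal_one]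
          simp [enorm_mul, this]
      _ ≤ _ := lintegral_mono_set (Ioc_subset_Ioo_right hu.2)
  have hmaps : MapsTo (fun u : ℝ => (u : ℂ) * ξ) (Icc 0 1) (closedBall 0 1) := fun u hu => by
    rw [mem_closedBall_zero_iff, norm_mul, hξ, mul_one, Complex.norm_real, Real.norm_eq_abs,
      abs_of_nonneg hu.1]
    exact hu.2
  have hc : ContinuousOn (fun u : ℝ => ‖f (t * ξ) - f (u * ξ)‖ₑ) (Icc 0 1) :=
    (continuousOn_const.sub (hf.2.comp (by fun_prop) hmaps)).enorm
  have hcl : (1 : ℝ) ∈ closure (Ioo t 1) := by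
    rw [closure_Ioo ht.ne]
    exact right_mem_Icc.2 ht.le
  have := le_on_closure (s := Ioo t 1) hbound
    (hc.mono (by rw [closure_Ioo ht.ne]; exact Icc_subset_Icc_left ht0.le)) continuousOn_const hcl
  simpa using this

/-- Component arcs of `𝕋 \ E_f` are Borel sets. -/
theorem IsCompArc.measurableSet {f : ℂ → ℂ} (hf : ContinuousOn f (closedBall 0 1)) {γ : Set ℂ}
    (hγ : IsCompArc f γ) : MeasurableSet γ := by
  obtain ⟨x, hx, rfl⟩ := hγ
  have hoff : MeasurableSet (offZeros f) := by
    have hcl : IsClosed (uCircle ∩ f ⁻¹' {0}) :=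
      (hf.mono sphere_subset_closedBall).preimage_isClosed_of_isClosed isClosed_sphere
        isClosed_singleton
    have : offZeros f = uCircle \ (uCircle ∩ f ⁻¹' {0}) := by
      ext ξ
      simp [offZeros]
    rw [this]
    exact isClosed_sphere.measurableSet.diff hcl.measurableSet
  have heq : connectedComponentIn (offZeros f) x =
      closure (connectedComponentIn (offZeros f) x) ∩ offZeros f := by
    refine Subset.antisymm
      (subset_inter subset_closure (connectedComponentIn_subset _ _)) ?_
    refine IsPreconnected.subset_connectedComponentIn
      (isPreconnected_connectedComponentIn.subset_closure
        (subset_inter subset_closure (connectedComponentIn_subset _ _)) inter_subset_left)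
      ⟨subset_closure (mem_connectedComponentIn hx), hx⟩ inter_subset_right
  rw [heq]
  exact isClosed_closure.measurableSet.inter hoff

/-- Sectors over Borel sets are Borel sets. -/
theorem measurableSet_discSector {γ : Set ℂ} (hγ : MeasurableSet γ) :
    MeasurableSet (discSector γ) := by
  have : Measurable fun z : ℂ => ((‖z‖ : ℂ))⁻¹ * z := by fun_prop
  exact isOpen_ball.measurableSet.inter (this hγ)

/-- Integration over a sector in polar coordinates. -/
theorem lintegral_discSector {γ : Set ℂ} (hγ : MeasurableSet γ) {F : ℂ → ℝ≥0∞}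
    (hF : Measurable F) :
    ∫⁻ z in discSector γ, F z = ∫⁻ θ in {θ : ℝ | exp (θ * I) ∈ γ} ∩ Ioo (-Real.pi) Real.pi,
      ∫⁻ r in Ioo (0 : ℝ) 1, ENNReal.ofReal r * F (r * exp (θ * I)) := by
  have hS := measurableSet_discSector hγ
  have hA : MeasurableSet {θ : ℝ | exp (θ * I) ∈ γ} := by
    have : Measurable fun θ : ℝ => exp (θ * I) := by fun_prop
    exact this hγ
  let H : ℝ × ℝ → ℝ≥0∞ := fun p =>
    ENNReal.ofReal p.1 * (discSector γ).indicator F (p.1 * exp (p.2 * I))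
  have hH : Measurable H := by
    have h1 : Measurable fun p : ℝ × ℝ => (p.1 : ℂ) * exp (p.2 * I) := by fun_prop
    exact (by fun_prop : Measurable fun p : ℝ × ℝ => ENNReal.ofReal p.1).mul
      ((hF.indicator hS).comp h1)
  have hmem : ∀ θ r : ℝ, 0 < r →
      ((r : ℂ) * exp (θ * I) ∈ discSector γ ↔ r < 1 ∧ exp (θ * I) ∈ γ) := fun θ r hr => by
    have hn : ‖(r : ℂ) * exp (θ * I)‖ = r := by
      rw [norm_mul, norm_exp_ofReal_mul_I, mul_one, Complex.norm_real, Real.norm_eq_abs,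
        abs_of_pos hr]
    have hr' : (r : ℂ) ≠ 0 := by exact_mod_cast hr.ne'
    simp only [discSector, mem_ofPred_eq, uDisc, mem_ball_zero_iff, hn]
    rw [inv_mul_cancel_left₀ hr']
  calc ∫⁻ z in discSector γ, F z
      = ∫⁻ p in Ioi (0 : ℝ) ×ˢ Ioo (-Real.pi) Real.pi, H p := by
        rw [← lintegral_indicator hS, ← Complex.lintegral_comp_polarCoord_symm,
          polarCoord_target]
        refine lintegral_congr fun p => ?_
        simp [H, Complex.polarCoord_symm_apply, Complex.exp_mul_I]
    _ = ∫⁻ θ in Ioo (-Real.pi) Real.pi, ∫⁻ r in Ioi (0 : ℝ), H (r, θ) := by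
        rw [Measure.volume_eq_prod, ← Measure.prod_restrict, lintegral_prod_symm _ hH.aemeasurable]
    _ = ∫⁻ θ in Ioo (-Real.pi) Real.pi, {θ : ℝ | exp (θ * I) ∈ γ}.indicator (fun θ =>
          ∫⁻ r in Ioo (0 : ℝ) 1, ENNReal.ofReal r * F (r * exp (θ * I))) θ := by
        refine lintegral_congr fun θ => ?_
        by_cases hθ : exp (θ * I) ∈ γ
        · rw [indicator_of_mem (by exact hθ), ← lintegral_indicator measurableSet_Ioi,
            ← lintegral_indicator measurableSet_Ioo]
          refine lintegral_congr fun r => ?_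
          by_cases hr : 0 < r <;> by_cases hr1 : r < 1 <;>
            simp [H, indicator, hr, hr1, hmem, hθ]
        · rw [indicator_of_notMem (by exact hθ), ← lintegral_indicator measurableSet_Ioi]
          refine (lintegral_congr fun r => ?_).trans lintegral_zero
          by_cases hr : 0 < r <;> simp [H, indicator, hr, hmem, hθ]
    _ = _ := by rw [lintegral_indicator hA, Measure.restrict_restrict hA]

/-- `∫_{Δ_γ} |f(z) − f(z/|z|)|^{2ρ}/(1−|z|)² dA(z) ≤ C_{α,ρ} ‖f'‖²_{L²(Δ_γ)}`. -/
theorem radial_difference_est (α ρ : ℝ) (hα0 : 0 < α) (hα1 : α ≤ 1/2) (hρ : 1 < ρ) :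
    ∃ C : ℝ, 0 < C ∧ ∀ (f : ℂ → ℂ) (γ : Set ℂ),
      MemA α f → ANorm α f ≤ 1 →
      IsCompArc f γ → volume (angSet γ) < ENNReal.ofReal (1/2) →
      nlint (discSector γ)
          (fun z => ‖f z - f (((‖z‖ : ℂ))⁻¹ * z)‖ ^ (2 * ρ) / (1 - ‖z‖) ^ 2) ≤
        ENNReal.ofReal C * nlint (discSector γ) (fun z => ‖deriv f z‖ ^ 2) := by
  refine ⟨4 * 2 ^ (2 * ρ - 2), by positivity, fun f γ hfA hN hγ _ => ?_⟩
  have hf : IsDiscReg f := hfA.2.1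
  have hγm := hγ.measurableSet hf.2
  have hγc : ∀ ξ ∈ γ, ‖ξ‖ = 1 := fun ξ hξ => by
    obtain ⟨x, _, rfl⟩ := hγ
    simpa [uCircle] using (connectedComponentIn_subset _ _ hξ).1
  -- a Borel function agreeing with `f` on the closed disc
  let g : ℂ → ℂ := (closedBall (0 : ℂ) 1).indicator f
  have hg : Measurable g := by
    have := hf.2.measurable_piecewise (g := 0) continuousOn_const
      isClosed_closedBall.measurableSet
    rwa [piecewise_eq_indicator] at this
  have hgf : ∀ z ∈ closedBall (0 : ℂ) 1, g z = f z := fun z hz => indicator_of_mem hz f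
  let F : ℂ → ℝ≥0∞ := fun z =>
    ENNReal.ofReal (‖g z - g (((‖z‖ : ℂ))⁻¹ * z)‖ ^ (2 * ρ) / (1 - ‖z‖) ^ 2)
  have hF : Measurable F := by fun_prop
  have hdf : Measurable fun z => ENNReal.ofReal (‖deriv f z‖ ^ 2) := by
    have := measurable_deriv f
    fun_prop
  have hleft : ∫⁻ z in discSector γ,
      ENNReal.ofReal (‖f z - f (((‖z‖ : ℂ))⁻¹ * z)‖ ^ (2 * ρ) / (1 - ‖z‖) ^ 2) =
      ∫⁻ z in discSector γ, F z := by
    refine setLIntegral_congr_fun (measurableSet_discSector hγm) fun z hz => ?_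
    simp only [F]
    rw [hgf z (ball_subset_closedBall hz.1), hgf _ (mem_closedBall_zero_iff.2 (hγc _ hz.2).le)]
  rw [nlint, nlint, mul_left_comm, hleft]
  refine mul_le_mul_right ?_ _
  rw [lintegral_discSector hγm hF, lintegral_discSector hγm hdf,
    ← lintegral_const_mul' _ _ ENNReal.ofReal_ne_top]
  have hA : MeasurableSet {θ : ℝ | exp (θ * I) ∈ γ} := by
    have : Measurable fun θ : ℝ => exp (θ * I) := by fun_prop
    exact this hγm
  refine setLIntegral_mono' (hA.inter measurableSet_Ioo) fun θ hθ => ?_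
  set ξ : ℂ := exp (θ * I)
  have hξ : ‖ξ‖ = 1 := norm_exp_ofReal_mul_I θ
  have hξ' : ξ ∈ closedBall (0 : ℂ) 1 := by simp [hξ]
  have hpt : ∀ r ∈ Ioo (0 : ℝ) 1, F (r * ξ) ≤ ENNReal.ofReal (2 ^ (2 * ρ - 2)) *
      (ENNReal.ofReal ((1 - r) ^ (-2 : ℝ)) * (∫⁻ s in Ioo r 1, ‖deriv f (s * ξ)‖ₑ) ^ 2) := by
    intro r hr
    have hn : ‖(r : ℂ) * ξ‖ = r := by
      rw [norm_mul, hξ, mul_one, Complex.norm_real, Real.norm_eq_abs, abs_of_pos hr.1]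
    have hr' : (r : ℂ) ≠ 0 := by exact_mod_cast hr.1.ne'
    have hmem : (r : ℂ) * ξ ∈ closedBall (0 : ℂ) 1 := by
      rw [mem_closedBall_zero_iff, hn]
      exact hr.2.le
    have h1 : 0 < 1 - r := by linarith [hr.2]
    have hle2 : ‖f (r * ξ) - f ξ‖ ≤ 2 :=
      (norm_sub_le _ _).trans (by
        linarith [norm_le_one_of_ANorm_le hf.2 hN hmem, norm_le_one_of_ANorm_le hf.2 hN hξ'])
    have hsplit : ‖f (r * ξ) - f ξ‖ ^ (2 * ρ) ≤ 2 ^ (2 * ρ - 2) * ‖f (r * ξ) - f ξ‖ ^ 2 := by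
      have h2 : 0 ≤ 2 * ρ - 2 := by linarith
      calc ‖f (r * ξ) - f ξ‖ ^ (2 * ρ)
          = ‖f (r * ξ) - f ξ‖ ^ (2 * ρ - 2) * ‖f (r * ξ) - f ξ‖ ^ 2 := by
            rw [← Real.rpow_natCast, ← Real.rpow_add_of_nonneg (norm_nonneg _) h2 (by norm_num)]
            norm_num
        _ ≤ _ := by gcongr
    simp only [F]
    rw [hn, inv_mul_cancel_left₀ hr', hgf _ hmem, hgf _ hξ']
    calc _ ≤ ENNReal.ofReal (2 ^ (2 * ρ - 2) *
          ((1 - r) ^ (-2 : ℝ) * ‖f (r * ξ) - f ξ‖ ^ 2)) := by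
          refine ENNReal.ofReal_le_ofReal ?_
          rw [Real.rpow_neg h1.le, Real.rpow_two, div_eq_mul_inv]
          calc _ ≤ (2 ^ (2 * ρ - 2) * ‖f (r * ξ) - f ξ‖ ^ 2) * ((1 - r) ^ 2)⁻¹ := by gcongr
            _ = _ := by ring
      _ = ENNReal.ofReal (2 ^ (2 * ρ - 2)) *
          (ENNReal.ofReal ((1 - r) ^ (-2 : ℝ)) * ‖f (r * ξ) - f ξ‖ₑ ^ 2) := by
          rw [ENNReal.ofReal_mul (by positivity), ENNReal.ofReal_mul (by positivity),
            ENNReal.ofReal_pow (norm_nonneg _), ofReal_norm]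
      _ ≤ _ := by
          gcongr
          exact enorm_radial_sub_le hf hξ hr.1 hr.2
  have hh : Measurable fun s : ℝ => ‖deriv f (s * ξ)‖ₑ := by
    have := measurable_deriv f
    fun_prop
  calc ∫⁻ r in Ioo (0 : ℝ) 1, ENNReal.ofReal r * F (r * ξ)
      ≤ ∫⁻ r in Ioo (0 : ℝ) 1, ENNReal.ofReal (2 ^ (2 * ρ - 2)) * (ENNReal.ofReal r *
          (ENNReal.ofReal ((1 - r) ^ (-2 : ℝ)) * (∫⁻ s in Ioo r 1, ‖deriv f (s * ξ)‖ₑ) ^ 2)) := by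
        refine setLIntegral_mono' measurableSet_Ioo fun r hr => ?_
        rw [mul_left_comm]
        gcongr
        exact hpt r hr
    _ ≤ ENNReal.ofReal (2 ^ (2 * ρ - 2)) *
          (4 * ∫⁻ s in Ioo (0 : ℝ) 1, ENNReal.ofReal s * ‖deriv f (s * ξ)‖ₑ ^ 2) := by
        rw [lintegral_const_mul' _ _ ENNReal.ofReal_ne_top]
        gcongr
        exact hardy_lintegral_le hh
    _ = _ := by
        rw [ENNReal.ofReal_mul (by norm_num), ENNReal.ofReal_ofNat, ← mul_assoc,
          mul_comm (4 : ℝ≥0∞)]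
        simp only [ENNReal.ofReal_pow (norm_nonneg _), ofReal_norm]
end
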